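/- arXiv:1603.02890 — 6 statements merged into one kernel-verified Lean document; each statement's English description precedes it below -/
import Mathlib

section
/- Fix an integer m ≥ 0. Under the stated hypotheses, for every integer n > m, writing fₙ = bₙ · ( a(β) + ∑_{k=1}^{m} (binom(k−c₁,k)/binom(n+c₁−1,k)) · (β^k/k!) · a^{(k)}(β) + E ), the error E satisfies |E| ≤ C_m · exp(3c₂r) · ( (r/n)^{m+1} · (c₂+m)_{m+1} + binom(n+c₂−1, n) · (4n²/c₁) · rⁿ ) for a constant C_m depending only on m; for m = 0 one may take C₀ = 24. -/
/-- Generalized binomial coefficient `binom(x, n) = x(x-1)⋯(x-n+1)/n!` for real `x`. -/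
noncomputable def rbinom (x : ℝ) (n : ℕ) : ℝ :=
  (∏ i ∈ Finset.range n, (x - (i : ℝ))) / (Nat.factorial n : ℝ)

/-- Falling factorial `(x)_n = x(x-1)⋯(x-n+1)` for real `x`. -/
noncomputable def ffall (x : ℝ) (n : ℕ) : ℝ :=
  ∏ i ∈ Finset.range n, (x - (i : ℝ))

/-- Taylor coefficients of `(1 - x)^(-c)`: `c(c+1)⋯(c+n-1)/n!`. -/
noncomputable def risingCoeff (c : ℝ) (n : ℕ) : ℝ :=
  (∏ j ∈ Finset.range n, (c + (j : ℝ))) / (Nat.factorial n : ℝ)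

theorem risingCoeff_zero (c : ℝ) : risingCoeff c 0 = 1 := by simp [risingCoeff]

theorem succ_mul_risingCoeff_succ (c : ℝ) (n : ℕ) :
    ((n : ℝ) + 1) * risingCoeff c (n + 1) = (c + n) * risingCoeff c n := by
  unfold risingCoeff
  rw [Finset.prod_range_succ, Nat.factorial_succ]
  push_cast
  have : (Nat.factorial n : ℝ) ≠ 0 := by positivity
  field_simp

theorem risingCoeff_pos {c : ℝ} (hc : 0 < c) (n : ℕ) : 0 < risingCoeff c n := by
  unfold risingCoeff
  have : 0 < ∏ j ∈ Finset.range n, (c + (j : ℝ)) := Finset.prod_pos fun j _ => by positivity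
  positivity

theorem prod_sub_eq_prod_add (c : ℝ) (n : ℕ) :
    ∏ i ∈ Finset.range n, ((n : ℝ) + c - 1 - (i : ℝ)) = ∏ j ∈ Finset.range n, (c + (j : ℝ)) := by
  rw [← Finset.prod_range_reflect]
  refine Finset.prod_congr rfl fun j hj => ?_
  have hj := Finset.mem_range.1 hj
  have : ((n - 1 - j : ℕ) : ℝ) = n - 1 - j := by
    rw [Nat.sub_sub, Nat.cast_sub (by omega)]; push_cast; ring
  rw [this]; ring

theorem rbinom_add_sub_one (c : ℝ) (n : ℕ) : rbinom ((n : ℝ) + c - 1) n = risingCoeff c n := by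
  rw [rbinom, risingCoeff, prod_sub_eq_prod_add]

theorem ffall_add_succ (c : ℝ) (m : ℕ) :
    ffall (c + m) (m + 1) = ∏ j ∈ Finset.range (m + 1), (c + (j : ℝ)) := by
  rw [← prod_sub_eq_prod_add, ffall]
  refine Finset.prod_congr rfl fun j _ => ?_
  push_cast; ring

theorem risingCoeff_eq_choose (c : ℝ) (n : ℕ) : risingCoeff c n = Ring.choose (c + n - 1) n := by
  have h := Ring.factorial_nsmul_multichoose_eq_ascPochhammer c n
  rw [Polynomial.ascPochhammer_smeval_eq_eval, Ring.multichoose_eq, nsmul_eq_mul] at h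
  have hp : ∀ k, (ascPochhammer ℝ k).eval c = ∏ j ∈ Finset.range k, (c + (j : ℝ)) := by
    intro k
    induction k with
    | zero => simp
    | succ k ih => rw [ascPochhammer_succ_eval, Finset.prod_range_succ, ih]
  rw [risingCoeff, ← hp, ← h]
  field_simp

theorem hasSum_risingCoeff (c : ℝ) {x : ℝ} (hx : |x| < 1) :
    HasSum (fun n => risingCoeff c n * x ^ n) (1 / (1 - x) ^ c) := by
  have h := (Real.one_div_one_sub_rpow_hasFPowerSeriesOnBall_zero c).hasSum (y := x) (by
    simpa [Metric.mem_eball, edist_dist, Real.dist_eq] using hx)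
  simpa [FormalMultilinearSeries.ofScalars_apply_eq, risingCoeff_eq_choose, mul_comm] using h

theorem succ_mul_risingCoeff_succ_eq_sum (c : ℝ) (n : ℕ) :
    ((n : ℝ) + 1) * risingCoeff c (n + 1) = c * ∑ k ∈ Finset.range (n + 1), risingCoeff c k := by
  induction n with
  | zero => simpa [risingCoeff_zero] using succ_mul_risingCoeff_succ c 0
  | succ n ih =>
    rw [Finset.sum_range_succ, mul_add, ← ih, succ_mul_risingCoeff_succ]
    push_cast; ring

/-- Taylor coefficients of `exp (∑ t (k+1) x^(k+1)/(k+1))`. -/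
noncomputable def expCoeff (t : ℕ → ℝ) : ℕ → ℝ
  | 0 => 1
  | n + 1 => (∑ k : Fin (n + 1), expCoeff t k * t (n - k + 1)) / ((n : ℝ) + 1)

theorem expCoeff_zero (t : ℕ → ℝ) : expCoeff t 0 = 1 := by rw [expCoeff]

theorem succ_mul_expCoeff_succ (t : ℕ → ℝ) (n : ℕ) :
    ((n : ℝ) + 1) * expCoeff t (n + 1) =
      ∑ k ∈ Finset.range (n + 1), expCoeff t k * t (n - k + 1) := by
  rw [expCoeff, mul_div_cancel₀ _ (by positivity),
    Finset.sum_range (fun k => expCoeff t k * t (n - k + 1))]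

theorem abs_expCoeff_le {t : ℕ → ℝ} {c α : ℝ}
    (ht : ∀ k : ℕ, 1 ≤ k → |t k| ≤ c / α ^ k) (n : ℕ) :
    |expCoeff t n| ≤ risingCoeff c n / α ^ n := by
  induction n using Nat.strong_induction_on with
  | _ n ih =>
    cases n with
    | zero => simp [expCoeff_zero, risingCoeff_zero]
    | succ n =>
      have hn : (0 : ℝ) < n + 1 := by positivity
      have h : |((n : ℝ) + 1) * expCoeff t (n + 1)| ≤
          (((n : ℝ) + 1) * risingCoeff c (n + 1)) / α ^ (n + 1) := by
        rw [succ_mul_expCoeff_succ, succ_mul_risingCoeff_succ_eq_sum, Finset.mul_sum,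
          Finset.sum_div]
        refine (Finset.abs_sum_le_sum_abs _ _).trans (Finset.sum_le_sum fun k hk => ?_)
        have hk' := Finset.mem_range.1 hk
        rw [abs_mul]
        have h1 := ih k hk'
        have h2 := ht (n - k + 1) (by omega)
        calc _ ≤ (risingCoeff c k / α ^ k) * (c / α ^ (n - k + 1)) :=
              mul_le_mul h1 h2 (abs_nonneg _) ((abs_nonneg _).trans h1)
          _ = _ := by
            rw [div_mul_div_comm, ← pow_add, mul_comm c]
            congr 2; omega
      rw [abs_mul, abs_of_pos hn, mul_div_assoc] at h
      exact le_of_mul_le_mul_left h hn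

theorem hasSum_congr_term {f g : ℕ → ℝ} {a : ℝ} (h : ∀ n, f n = g n) :
    HasSum f a ↔ HasSum g a := by
  rw [funext h]

/-- Termwise differentiation of a convergent real power series. -/
theorem hasDerivAt_of_hasSum_pow {c : ℕ → ℝ} {f : ℝ → ℝ} {R : ℝ}
    (hf : ∀ x, |x| < R → HasSum (fun n => c n * x ^ n) (f x)) {x : ℝ} (hx : |x| < R) :
    ∃ f', HasSum (fun n : ℕ => ((n : ℝ) + 1) * c (n + 1) * x ^ n) f' ∧ HasDerivAt f f' x := by
  obtain ⟨ρ, hxρ, hρR⟩ := exists_between hx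
  obtain ⟨σ, hρσ, hσR⟩ := exists_between hρR
  have hρ : 0 < ρ := (abs_nonneg x).trans_lt hxρ
  have hσ : 0 < σ := hρ.trans hρσ
  obtain ⟨B, hB⟩ : ∃ B, ∀ n, |c n| * σ ^ n ≤ B := by
    have hs := (hf σ (by rwa [abs_of_pos hσ])).summable.abs
    refine ⟨∑' n, |c n * σ ^ n|, fun n => ?_⟩
    have := hs.le_tsum n (fun _ _ => abs_nonneg _)
    rwa [abs_mul, abs_of_pos (pow_pos hσ n)] at this
  have hu : Summable fun n : ℕ => |c n| * ((n : ℝ) * ρ ^ (n - 1)) := by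
    have hq : ‖ρ / σ‖ < 1 := by
      rw [Real.norm_of_nonneg (by positivity), div_lt_one hσ]; exact hρσ
    have h1 := (summable_pow_mul_geometric_of_norm_lt_one 1 hq).mul_left (B / ρ)
    refine Summable.of_nonneg_of_le (fun n => by positivity) (fun n => ?_) h1
    cases n with
    | zero => simp
    | succ n =>
      have := hB (n + 1)
      calc |c (n + 1)| * (((n + 1 : ℕ) : ℝ) * ρ ^ n)
          = (|c (n + 1)| * σ ^ (n + 1)) * (((n + 1 : ℕ) : ℝ) * ρ ^ n / σ ^ (n + 1)) := by
            field_simp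
        _ ≤ B * (((n + 1 : ℕ) : ℝ) * ρ ^ n / σ ^ (n + 1)) := by gcongr
        _ = _ := by rw [div_pow]; field_simp; ring
  have hball : ∀ y, y ∈ Metric.ball (0 : ℝ) ρ ↔ |y| < ρ := by simp
  have hbd : ∀ n y, y ∈ Metric.ball (0 : ℝ) ρ →
      ‖c n * ((n : ℝ) * y ^ (n - 1))‖ ≤ |c n| * ((n : ℝ) * ρ ^ (n - 1)) := by
    intro n y hy
    rw [hball] at hy
    simp only [norm_mul, norm_pow, Real.norm_eq_abs, Nat.abs_cast]
    gcongr
  have hx' := (hball x).2 hxρ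
  have hd := hasDerivAt_tsum_of_isPreconnected hu Metric.isOpen_ball
    (convex_ball (0 : ℝ) ρ).isPreconnected
    (g := fun n y => c n * y ^ n) (g' := fun n y => c n * ((n : ℝ) * y ^ (n - 1)))
    (fun n y _ => (hasDerivAt_pow n y).const_mul (c n)) hbd
    hx' (hf x hx).summable hx'
  have hs : Summable fun n : ℕ => c n * ((n : ℝ) * x ^ (n - 1)) :=
    Summable.of_norm_bounded hu fun n => hbd n x hx'
  refine ⟨_, ?_, hd.congr_of_eventuallyEq ?_⟩
  · have := (hasSum_nat_add_iff' 1).2 hs.hasSum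
    simp only [Finset.range_one, Finset.sum_singleton, Nat.cast_zero, zero_mul, mul_zero,
      sub_zero] at this
    refine (hasSum_congr_term fun n => ?_).1 this
    push_cast
    ring
  · filter_upwards [Metric.isOpen_ball.mem_nhds hx'] with y hy
    exact (hf y (((hball y).1 hy).trans hρR)).tsum_eq.symm

theorem hasSum_iteratedDeriv_of_hasSum_pow {c : ℕ → ℝ} {f : ℝ → ℝ} {R : ℝ}
    (hf : ∀ x, |x| < R → HasSum (fun n => c n * x ^ n) (f x)) (k : ℕ) :
    ∀ x, |x| < R → HasSum (fun n => ((n + k).descFactorial k : ℝ) * c (n + k) * x ^ n)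
      (iteratedDeriv k f x) := by
  induction k with
  | zero => simpa using hf
  | succ k ih =>
    intro x hx
    obtain ⟨f', h1, h2⟩ := hasDerivAt_of_hasSum_pow ih hx
    rw [iteratedDeriv_succ, h2.deriv]
    refine (hasSum_congr_term fun n => ?_).2 h1
    have : (n + (k + 1)).descFactorial (k + 1) = (n + 1) * (n + 1 + k).descFactorial k := by
      rw [Nat.descFactorial_succ, show n + (k + 1) - k = n + 1 by omega,
        show n + (k + 1) = n + 1 + k by omega]
    rw [this, show n + 1 + k = n + (k + 1) by omega]
    push_cast; ring

theorem hasSum_choose_iteratedDeriv {c : ℕ → ℝ} {f : ℝ → ℝ} {R : ℝ}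
    (hf : ∀ x, |x| < R → HasSum (fun n => c n * x ^ n) (f x)) (k : ℕ) {x : ℝ} (hx : |x| < R) :
    HasSum (fun n => (n.choose k : ℝ) * (c n * x ^ n))
      (x ^ k / (k.factorial : ℝ) * iteratedDeriv k f x) := by
  have h := (hasSum_iteratedDeriv_of_hasSum_pow hf k x hx).mul_left (x ^ k / (k.factorial : ℝ))
  rw [← hasSum_nat_add_iff' k]
  rw [Finset.sum_eq_zero, sub_zero]
  · refine (hasSum_congr_term fun n => ?_).2 h
    rw [Nat.descFactorial_eq_factorial_mul_choose, pow_add]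
    push_cast
    field_simp
  · intro i hi
    rw [Nat.choose_eq_zero_of_lt (Finset.mem_range.1 hi)]; simp

theorem iteratedDeriv_zero_div_factorial {c : ℕ → ℝ} {f : ℝ → ℝ} {R : ℝ} (hR : 0 < R)
    (hf : ∀ x, |x| < R → HasSum (fun n => c n * x ^ n) (f x)) (k : ℕ) :
    iteratedDeriv k f 0 / (k.factorial : ℝ) = c k := by
  have h := hasSum_iteratedDeriv_of_hasSum_pow hf k 0 (by simpa using hR)
  have h2 := hasSum_single (f := fun n => ((n + k).descFactorial k : ℝ) * c (n + k) * 0 ^ n) 0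
    (by intro n hn; simp [hn])
  rw [h.unique h2]
  simp [Nat.descFactorial_self]
  field_simp

theorem hasSum_exp_of_abs_le {t : ℕ → ℝ} {c α : ℝ} (hα : 0 < α) (hc : 0 < c)
    (ht : ∀ k : ℕ, 1 ≤ k → |t k| ≤ c / α ^ k) {x : ℝ} (hx : |x| < α) :
    HasSum (fun n => expCoeff t n * x ^ n)
      (Real.exp (∑' k : ℕ, t (k + 1) * x ^ (k + 1) / ((k : ℝ) + 1))) := by
  have hq : ∀ {y : ℝ}, |y| < α → |(|y| / α)| < 1 := fun {y} hy => by
    rw [abs_of_nonneg (by positivity), div_lt_one hα]; exact hy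
  have hFabs : ∀ y, |y| < α → Summable fun n => |expCoeff t n * y ^ n| := by
    intro y hy
    refine Summable.of_nonneg_of_le (fun _ => abs_nonneg _) (fun n => ?_)
      (hasSum_risingCoeff c (hq hy)).summable
    rw [abs_mul, abs_pow, div_pow, mul_div_assoc', mul_div_right_comm]
    gcongr
    exact abs_expCoeff_le ht n
  have htabs : ∀ y, |y| < α → Summable fun n => |t (n + 1) * y ^ n| := by
    intro y hy
    have hg := (summable_geometric_of_abs_lt_one (hq hy)).mul_left (c / α)
    refine Summable.of_nonneg_of_le (fun _ => abs_nonneg _) (fun n => ?_) hg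
    rw [abs_mul, abs_pow]
    calc |t (n + 1)| * |y| ^ n ≤ c / α ^ (n + 1) * |y| ^ n := by
          gcongr; exact ht _ (by omega)
      _ = _ := by rw [div_pow]; field_simp; ring
  set g : ℝ → ℝ := fun y => ∑' k : ℕ, t (k + 1) * y ^ (k + 1) / ((k : ℝ) + 1) with hg
  set gc : ℕ → ℝ := fun n => t n / n with hgc
  have hgsum : ∀ y, |y| < α → HasSum (fun n => gc n * y ^ n) (g y) := by
    intro y hy
    have h1 : Summable fun k : ℕ => t (k + 1) * y ^ (k + 1) / ((k : ℝ) + 1) := by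
      refine Summable.of_norm_bounded ((htabs y hy).mul_left |y|) fun n => ?_
      rw [norm_div, norm_mul, norm_pow, abs_mul, abs_pow, pow_succ]
      simp only [Real.norm_eq_abs]
      rw [abs_of_nonneg (by positivity : (0 : ℝ) ≤ n + 1)]
      refine (div_le_self (by positivity) (by linarith [(Nat.cast_nonneg n : (0 : ℝ) ≤ n)])).trans ?_
      apply le_of_eq; ring
    have h2 := h1.hasSum
    rw [← hasSum_nat_add_iff' 1]
    simp only [hgc, hg, Finset.range_one, Finset.sum_singleton, Nat.cast_zero, div_zero, zero_mul,
      sub_zero]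
    refine (hasSum_congr_term fun n => ?_).2 h2
    push_cast; ring
  set F : ℝ → ℝ := fun y => ∑' n, expCoeff t n * y ^ n with hF
  have hFsum : ∀ y, |y| < α → HasSum (fun n => expCoeff t n * y ^ n) (F y) := fun y hy =>
    (hFabs y hy).of_abs.hasSum
  have hderiv : ∀ y, |y| < α → HasDerivAt (fun y => F y * Real.exp (-g y)) 0 y := by
    intro y hy
    obtain ⟨F', hF1, hF2⟩ := hasDerivAt_of_hasSum_pow hFsum hy
    obtain ⟨g', hg1, hg2⟩ := hasDerivAt_of_hasSum_pow hgsum hy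
    have hg1' : HasSum (fun n => t (n + 1) * y ^ n) g' := by
      refine (hasSum_congr_term fun n => ?_).2 hg1
      simp only [hgc]; push_cast; field_simp
    have hprod : F' = F y * g' := by
      have hcp := tsum_mul_tsum_eq_tsum_sum_range_of_summable_norm
        (f := fun n => expCoeff t n * y ^ n) (g := fun n => t (n + 1) * y ^ n)
        (by simpa only [Real.norm_eq_abs] using hFabs y hy)
        (by simpa only [Real.norm_eq_abs] using htabs y hy)
      rw [(hFsum y hy).tsum_eq, hg1'.tsum_eq] at hcp
      rw [hcp, ← hF1.tsum_eq]
      refine tsum_congr fun n => ?_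
      rw [succ_mul_expCoeff_succ, Finset.sum_mul]
      refine Finset.sum_congr rfl fun k hk => ?_
      have hk' : k ≤ n := Nat.lt_succ_iff.1 (Finset.mem_range.1 hk)
      rw [← Nat.add_sub_cancel' hk', pow_add]
      simp only [Nat.add_sub_cancel_left]
      ring
    refine (hF2.mul hg2.neg.exp).congr_deriv ?_
    rw [hprod]; ring
  have hconst : F x * Real.exp (-g x) = F 0 * Real.exp (-g 0) := by
    have hball : ∀ y, y ∈ Metric.ball (0 : ℝ) α ↔ |y| < α := by simp
    refine (convex_ball (0 : ℝ) α).is_const_of_fderivWithin_eq_zero (𝕜 := ℝ)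
      (f := fun y => F y * Real.exp (-g y)) ?_ ?_ ((hball x).2 hx) (by simpa using hα)
    · intro y hy
      exact (hderiv y ((hball y).1 hy)).differentiableAt.differentiableWithinAt
    · intro y hy
      have := (hderiv y ((hball y).1 hy)).hasFDerivAt
      rw [(this.hasFDerivWithinAt).fderivWithin (Metric.isOpen_ball.uniqueDiffWithinAt hy)]
      ext; simp
  have hF0 : F 0 = 1 := by
    have h2 := hasSum_single (f := fun n => expCoeff t n * (0 : ℝ) ^ n) 0
      (by intro n hn; simp [hn])
    rw [(hFsum 0 (by simpa using hα)).unique h2]; simp [expCoeff_zero]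
  have hg0 : g 0 = 0 := by simp [hg]
  rw [hF0, hg0, neg_zero, Real.exp_zero, mul_one, Real.exp_neg] at hconst
  have : F x = Real.exp (g x) := by
    field_simp at hconst
    exact hconst
  rw [← this]
  exact hFsum x hx

theorem succ_mul_risingCoeff_succ_eq_mul (c : ℝ) (n : ℕ) :
    ((n : ℝ) + 1) * risingCoeff c (n + 1) = c * risingCoeff (c + 1) n := by
  unfold risingCoeff
  rw [Finset.prod_range_succ', Nat.factorial_succ]
  have h : ∀ j ∈ Finset.range n, c + ((j + 1 : ℕ) : ℝ) = c + 1 + (j : ℝ) := fun j _ => by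
    push_cast; ring
  rw [Finset.prod_congr rfl h]
  push_cast
  have : (Nat.factorial n : ℝ) ≠ 0 := by positivity
  field_simp
  ring

theorem risingCoeff_add_le {c : ℝ} (hc : 0 < c) (n l : ℕ) :
    risingCoeff c (n + l) ≤ risingCoeff c n * risingCoeff (c + 1) l := by
  induction l with
  | zero => simp [risingCoeff_zero]
  | succ l ih =>
    have h1 := succ_mul_risingCoeff_succ c (n + l)
    have h2 := succ_mul_risingCoeff_succ (c + 1) l
    push_cast at h1
    have hpos : (0 : ℝ) < (n : ℝ) + l + 1 := by positivity
    have hl : (0 : ℝ) < (l : ℝ) + 1 := by positivity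
    have e1 : risingCoeff c (n + (l + 1)) = (c + (n + l)) / (n + l + 1) * risingCoeff c (n + l) := by
      rw [div_mul_eq_mul_div, eq_div_iff hpos.ne', ← h1, ← add_assoc]; ring
    have e2 : risingCoeff (c + 1) (l + 1) = (c + 1 + l) / (l + 1) * risingCoeff (c + 1) l := by
      rw [div_mul_eq_mul_div, eq_div_iff hl.ne', ← h2]; ring
    have hq : (c + ((n : ℝ) + l)) / (n + l + 1) ≤ (c + 1 + l) / (l + 1) := by
      rw [div_le_div_iff₀ hpos hl]
      nlinarith [(Nat.cast_nonneg n : (0 : ℝ) ≤ n), (Nat.cast_nonneg l : (0 : ℝ) ≤ l),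
        mul_nonneg hc.le (Nat.cast_nonneg n : (0 : ℝ) ≤ n)]
    rw [e1, e2]
    calc _ ≤ (c + 1 + l) / (l + 1) * (risingCoeff c n * risingCoeff (c + 1) l) :=
          mul_le_mul hq ih (risingCoeff_pos hc _).le (by positivity)
      _ = _ := by ring

theorem risingCoeff_add_mul_choose (c : ℝ) (s j : ℕ) :
    risingCoeff c (s + j) * ((s + j).choose s : ℝ) * (s.factorial : ℝ) =
      (∏ i ∈ Finset.range s, (c + (i : ℝ))) * risingCoeff (c + s) j := by
  have h : (((s + j).choose s : ℝ)) * s.factorial * j.factorial = (s + j).factorial := by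
    rw [Nat.choose_symm_add]
    exact_mod_cast Nat.add_choose_mul_factorial_mul_factorial s j
  unfold risingCoeff
  rw [Finset.prod_range_add, ← h]
  have h2 : ∀ i ∈ Finset.range j, c + ((s + i : ℕ) : ℝ) = c + s + (i : ℝ) := fun i _ => by
    push_cast; ring
  rw [Finset.prod_congr rfl h2]
  have h3 : ((s + j).choose s : ℝ) ≠ 0 := by
    exact_mod_cast (Nat.choose_pos (Nat.le_add_right s j)).ne'
  have h4 : (s.factorial : ℝ) ≠ 0 := by positivity
  have h5 : (j.factorial : ℝ) ≠ 0 := by positivity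
  field_simp

theorem div_le_risingCoeff {c : ℝ} (hc : 0 < c) {n : ℕ} (hn : 1 ≤ n) : c / n ≤ risingCoeff c n := by
  induction n, hn using Nat.le_induction with
  | base => simp [risingCoeff]
  | succ n hn ih =>
    have h := succ_mul_risingCoeff_succ c n
    have hn0 : (0 : ℝ) < n := by exact_mod_cast hn
    rw [div_le_iff₀ (by positivity)]
    push_cast
    rw [mul_comm, h]
    rw [div_le_iff₀ hn0] at ih
    nlinarith [risingCoeff_pos hc n]

/-- The ratios `binom(k-c, k) / binom(n+c-1, k)`. -/
noncomputable def shiftRatio (c x : ℝ) (k : ℕ) : ℝ :=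
  ∏ j ∈ Finset.range k, (((j : ℝ) + 1 - c) / (x - j - 1 + c))

theorem rbinom_div_rbinom (c x : ℝ) (k : ℕ) :
    rbinom ((k : ℝ) - c) k / rbinom (x + c - 1) k = shiftRatio c x k := by
  have h := prod_sub_eq_prod_add (1 - c) k
  rw [show (k : ℝ) + (1 - c) - 1 = k - c by ring] at h
  rw [rbinom, rbinom, h, div_div_div_cancel_right₀ (by positivity), shiftRatio,
    Finset.prod_div_distrib]
  congr 1
  · exact Finset.prod_congr rfl fun j _ => by ring
  · exact Finset.prod_congr rfl fun j _ => by ring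

theorem shiftRatio_succ' (c x : ℝ) (k : ℕ) :
    shiftRatio c x (k + 1) = (1 - c) / (x - 1 + c) * shiftRatio (c - 1) x k := by
  rw [shiftRatio, Finset.prod_range_succ', shiftRatio, mul_comm]
  congr 1
  · simp
  · refine Finset.prod_congr rfl fun j _ => ?_
    push_cast; congr 1 <;> ring

/-- A form of the Chu–Vandermonde identity. -/
theorem sum_choose_mul_shiftRatio (x : ℝ) (i : ℕ) : ∀ c : ℝ,
    (∀ j : ℕ, j < i → x - j - 1 + c ≠ 0) →
    ∑ k ∈ Finset.range (i + 1), (i.choose k : ℝ) * shiftRatio c x k =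
      ∏ j ∈ Finset.range i, ((x - j) / (x - j - 1 + c)) := by
  induction i with
  | zero => intro c _; simp [shiftRatio]
  | succ i ih =>
    intro c hc
    have h1 := ih c fun j hj => hc j (by omega)
    have h2 := ih (c - 1) fun j hj => by
      have := hc (j + 1) (by omega)
      push_cast at this
      intro h0; apply this; linarith
    have hx : x - 1 + c ≠ 0 := by simpa using hc 0 (by omega)
    have hi := hc i (by omega)
    have h3 : (∏ j ∈ Finset.range i, ((x - j) / (x - j - 1 + (c - 1)))) * (x - i - 1 + c) =
        (∏ j ∈ Finset.range i, ((x - j) / (x - j - 1 + c))) * (x - 1 + c) := by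
      rw [Finset.prod_div_distrib, Finset.prod_div_distrib]
      have h4 : (∏ j ∈ Finset.range i, (x - j - 1 + (c - 1))) * (x - 1 + c) =
          (∏ j ∈ Finset.range i, (x - j - 1 + c)) * (x - i - 1 + c) := by
        rw [← Finset.prod_range_succ (fun j : ℕ => x - j - 1 + c), Finset.prod_range_succ']
        congr 1
        · exact Finset.prod_congr rfl fun j _ => by push_cast; ring
        · simp
      have n1 : ∏ j ∈ Finset.range i, (x - j - 1 + (c - 1)) ≠ 0 :=
        Finset.prod_ne_zero_iff.2 fun j hj => by
          have := hc (j + 1) (by have := Finset.mem_range.1 hj; omega)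
          push_cast at this
          intro h0; apply this; linarith
      have n2 : ∏ j ∈ Finset.range i, (x - j - 1 + c) ≠ 0 :=
        Finset.prod_ne_zero_iff.2 fun j hj => hc j (by have := Finset.mem_range.1 hj; omega)
      rw [div_mul_eq_mul_div, div_mul_eq_mul_div, div_eq_div_iff n1 n2, mul_assoc, mul_assoc]
      congr 1
      rw [mul_comm _ (∏ j ∈ Finset.range i, (x - j - 1 + c)), ← h4]; ring
    have key : ∑ k ∈ Finset.range (i + 2), ((i + 1).choose k : ℝ) * shiftRatio c x k =
        ∑ k ∈ Finset.range (i + 1), (i.choose k : ℝ) * shiftRatio c x k +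
          (1 - c) / (x - 1 + c) *
            ∑ k ∈ Finset.range (i + 1), (i.choose k : ℝ) * shiftRatio (c - 1) x k := by
      rw [Finset.sum_range_succ']
      have e : ∀ k ∈ Finset.range (i + 1),
          ((i + 1).choose (k + 1) : ℝ) * shiftRatio c x (k + 1) =
          (1 - c) / (x - 1 + c) * ((i.choose k : ℝ) * shiftRatio (c - 1) x k) +
            (i.choose (k + 1) : ℝ) * shiftRatio c x (k + 1) := fun k _ => by
        rw [Nat.choose_succ_succ]; push_cast; rw [add_mul]
        nth_rw 1 [shiftRatio_succ']; ring
      rw [Finset.sum_congr rfl e, Finset.sum_add_distrib, ← Finset.mul_sum,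
        Finset.sum_range_succ (fun k => (i.choose (k + 1) : ℝ) * shiftRatio c x (k + 1)),
        Nat.choose_succ_self, Finset.sum_range_succ' (fun k => (i.choose k : ℝ) * shiftRatio c x k)]
      simp only [Nat.choose_zero_right]
      push_cast; ring
    rw [key, h1, h2, Finset.prod_range_succ]
    rw [← eq_div_iff hi] at h3
    rw [h3]
    field_simp
    ring

theorem shiftRatio_nonneg {c : ℝ} (hc0 : 0 < c) (hc1 : c < 1) {n k : ℕ} (hk : k ≤ n) :
    0 ≤ shiftRatio c n k := by
  refine Finset.prod_nonneg fun j hj => ?_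
  have : (j : ℝ) + 1 ≤ n := by exact_mod_cast (Finset.mem_range.1 hj).trans_le hk
  refine div_nonneg ?_ ?_
  · linarith [(Nat.cast_nonneg j : (0 : ℝ) ≤ j)]
  · linarith

theorem risingCoeff_sub_div {c : ℝ} (hc : 0 < c) {n i : ℕ} (hi : i ≤ n) :
    risingCoeff c (n - i) / risingCoeff c n =
      ∑ k ∈ Finset.range (i + 1), (i.choose k : ℝ) * shiftRatio c n k := by
  rw [sum_choose_mul_shiftRatio]
  · induction i with
    | zero => simp [(risingCoeff_pos hc n).ne']
    | succ i ih =>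
      rw [Finset.prod_range_succ, ← ih (by omega)]
      obtain ⟨p, rfl⟩ := Nat.exists_eq_add_of_le hi
      have h := succ_mul_risingCoeff_succ c p
      rw [show i + 1 + p - (i + 1) = p by omega, show i + 1 + p - i = p + 1 by omega]
      push_cast
      rw [show (i : ℝ) + 1 + p - i = p + 1 by ring, show (p : ℝ) + 1 - 1 + c = c + p by ring,
        div_mul_div_comm, mul_comm (risingCoeff c (p + 1)), h]
      have h1 : c + (p : ℝ) ≠ 0 := by positivity
      have h2 := (risingCoeff_pos hc (i + 1 + p)).ne'
      field_simp
  · intro j hj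
    have : (j : ℝ) + 1 ≤ n := by exact_mod_cast hj.trans_le hi
    linarith

theorem choose_mul_shiftRatio_succ_le {c : ℝ} (hc0 : 0 < c) (hc1 : c < 1) {n i : ℕ} (hi : i < n)
    (k : ℕ) :
    (i.choose (k + 1) : ℝ) * shiftRatio c n (k + 1) ≤ (i.choose k : ℝ) * shiftRatio c n k := by
  rcases lt_or_ge k i with hk | hk
  · have hD := shiftRatio_nonneg hc0 hc1 (n := n) (k := k) (by omega)
    have h1 : (i.choose (k + 1) : ℝ) * (k + 1) = i.choose k * ((i : ℝ) - k) := by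
      rw [← Nat.cast_sub hk.le]; exact_mod_cast Nat.choose_succ_right_eq i k
    have hin : (i : ℝ) + 1 ≤ n := by exact_mod_cast hi
    have hki : (k : ℝ) + 1 ≤ i := by exact_mod_cast hk
    have hk0 : (0 : ℝ) ≤ k := Nat.cast_nonneg k
    have hden : 0 < (n : ℝ) - k - 1 + c := by linarith
    have e : shiftRatio c n (k + 1) = shiftRatio c n k * ((k + 1 - c) / (n - k - 1 + c)) := by
      rw [shiftRatio, Finset.prod_range_succ]; rfl
    have hC : (0 : ℝ) ≤ i.choose k := Nat.cast_nonneg _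
    have hC1 : (0 : ℝ) ≤ i.choose (k + 1) := Nat.cast_nonneg _
    rw [e]
    have : (i.choose (k + 1) : ℝ) * ((k + 1 - c) / (n - k - 1 + c)) ≤ i.choose k := by
      rw [mul_div_assoc', div_le_iff₀ hden]
      nlinarith [mul_nonneg hC1 hc0.le, mul_nonneg hC hc0.le,
        mul_nonneg hC (by linarith : (0 : ℝ) ≤ n - i - 1)]
    calc _ = (i.choose (k + 1) : ℝ) * ((k + 1 - c) / (n - k - 1 + c)) * shiftRatio c n k := by ring
      _ ≤ _ := by gcongr
  · rw [Nat.choose_eq_zero_of_lt (by omega : i < k + 1)]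
    rcases hk.eq_or_lt with rfl | hk
    · simpa using shiftRatio_nonneg hc0 hc1 hi.le
    · rw [Nat.choose_eq_zero_of_lt hk]; simp

theorem sum_Ico_choose_mul_shiftRatio_le {c : ℝ} (hc0 : 0 < c) (hc1 : c < 1) {m n i : ℕ}
    (hi : i < n) (hm : m ≤ i) :
    ∑ k ∈ Finset.Ico (m + 1) (i + 1), (i.choose k : ℝ) * shiftRatio c n k ≤
      ((i : ℝ) - m) * ((i.choose (m + 1) : ℝ) * shiftRatio c n (m + 1)) := by
  have hanti : Antitone fun k => (i.choose k : ℝ) * shiftRatio c n k :=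
    antitone_nat_of_succ_le (choose_mul_shiftRatio_succ_le hc0 hc1 hi)
  refine (Finset.sum_le_card_nsmul _ _ _ fun k hk => hanti (Finset.mem_Ico.1 hk).1).trans ?_
  rw [Nat.card_Ico, nsmul_eq_mul, Nat.add_sub_add_right, Nat.cast_sub hm]

theorem shiftRatio_succ_le {c : ℝ} (hc0 : 0 < c) (hc1 : c < 1) {m n : ℕ} (hn : m + 2 ≤ n) :
    shiftRatio c n (m + 1) ≤
      ((m + 1).factorial : ℝ) * ((m + 2).factorial : ℝ) / (n : ℝ) ^ (m + 1) := by
  have hn0 : (0 : ℝ) < n := by exact_mod_cast (by omega : 0 < n)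
  have h : ∀ k, (k : ℕ) ≤ m + 1 →
      shiftRatio c n k ≤ (k.factorial : ℝ) * ((k + 1).factorial : ℝ) / (n : ℝ) ^ k := by
    intro k
    induction k with
    | zero => simp [shiftRatio]
    | succ k ih =>
      intro hk
      have hk' : (k : ℝ) + 2 ≤ n := by exact_mod_cast (by omega : k + 2 ≤ n)
      have hk0 : (0 : ℝ) ≤ k := Nat.cast_nonneg k
      have hq : ((k : ℝ) + 1 - c) / (n - k - 1 + c) ≤ (k + 1) * (k + 2) / n := by
        rw [div_le_div_iff₀ (by linarith) hn0]
        nlinarith [mul_nonneg (by linarith : (0 : ℝ) ≤ k + 1) (mul_nonneg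
          (by linarith : (0 : ℝ) ≤ k + 1) (by linarith : (0 : ℝ) ≤ (n : ℝ) - k - 2)),
          mul_nonneg hc0.le hn0.le, mul_nonneg (by positivity : (0 : ℝ) ≤ (k + 1) * (k + 2)) hc0.le]
      rw [shiftRatio, Finset.prod_range_succ]
      calc _ ≤ ((k.factorial : ℝ) * ((k + 1).factorial : ℝ) / (n : ℝ) ^ k) *
            ((k + 1) * (k + 2) / n) :=
            mul_le_mul (ih (by omega)) hq (div_nonneg (by linarith) (by linarith)) (by positivity)
        _ = _ := by
          rw [Nat.factorial_succ (k + 1), Nat.factorial_succ k]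
          push_cast
          field_simp
          ring
  exact h (m + 1) le_rfl

theorem choose_mul_shiftRatio_le_pow {c : ℝ} (hc0 : 0 < c) (hc1 : c < 1) {n k : ℕ} (hk : k < n)
    (l : ℕ) :
    ((n + l).choose k : ℝ) * shiftRatio c n k ≤ ((l : ℝ) + 2) ^ k := by
  induction k with
  | zero => simp [shiftRatio]
  | succ k ih =>
    have hk' : (k : ℝ) + 2 ≤ n := by exact_mod_cast (by omega : k + 2 ≤ n)
    have hk0 : (0 : ℝ) ≤ k := Nat.cast_nonneg k
    have hl0 : (0 : ℝ) ≤ l := Nat.cast_nonneg l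
    have hc : ((n + l).choose (k + 1) : ℝ) = (n + l).choose k * (((n : ℝ) + l - k) / (k + 1)) := by
      rw [mul_div_assoc', eq_div_iff (by positivity)]
      have := Nat.choose_succ_right_eq (n + l) k
      have h2 : ((n + l - k : ℕ) : ℝ) = n + l - k := by
        rw [Nat.cast_sub (by omega)]; push_cast; ring
      rw [← h2]; exact_mod_cast this
    have hq : ((n : ℝ) + l - k) / (k + 1) * ((k + 1 - c) / (n - k - 1 + c)) ≤ l + 2 := by
      rw [div_mul_div_comm, div_le_iff₀ (by nlinarith)]
      have h1 : ((n : ℝ) + l - k) ≤ (l + 2) * (n - k - 1 + c) := by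
        nlinarith [mul_nonneg (by linarith : (0 : ℝ) ≤ l + 1) (by linarith : (0 : ℝ) ≤ (n : ℝ) - k - 2),
          mul_nonneg (by linarith : (0 : ℝ) ≤ l + 2) hc0.le]
      calc _ ≤ ((n : ℝ) + l - k) * (k + 1) := by
            apply mul_le_mul_of_nonneg_left <;> linarith
        _ ≤ (l + 2) * (n - k - 1 + c) * (k + 1) := by gcongr
        _ = _ := by ring
    rw [shiftRatio, Finset.prod_range_succ, hc, pow_succ]
    calc _ = ((n + l).choose k : ℝ) * shiftRatio c n k *
          (((n : ℝ) + l - k) / (k + 1) * ((k + 1 - c) / (n - k - 1 + c))) := by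
          rw [shiftRatio]; ring
      _ ≤ _ := by
        refine mul_le_mul (ih (by omega)) hq ?_ (by positivity)
        exact mul_nonneg (div_nonneg (by linarith) (by linarith))
          (div_nonneg (by linarith) (by linarith))

theorem one_div_one_sub_le_exp {r : ℝ} (hr0 : 0 < r) (hr : r ^ 2 ≤ 1 / 2) :
    1 / (1 - r) ≤ Real.exp (2 * r) := by
  have hr1 : r < 1 := by nlinarith
  have h := Real.quadratic_le_exp_of_nonneg (x := 2 * r) (by positivity)
  rw [div_le_iff₀ (by linarith)]
  have h2 : 1 ≤ (1 + 2 * r + (2 * r) ^ 2 / 2) * (1 - r) := by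
    nlinarith [mul_le_mul_of_nonneg_left hr hr0.le]
  exact h2.trans (mul_le_mul_of_nonneg_right h (by linarith))

theorem one_div_one_sub_scaled_le_exp {r : ℝ} (hr0 : 0 < r) (hr : r ^ 2 ≤ 1 / 2) :
    1 / (1 - 10 / 9 * r) ≤ Real.exp (3 * r) := by
  have hr1 : r < 71 / 100 := by nlinarith
  have h := Real.sum_le_exp_of_nonneg (x := 3 * r) (by positivity) 4
  rw [div_le_iff₀ (by linarith)]
  simp only [Finset.sum_range_succ, Finset.sum_range_zero, Nat.factorial] at h
  norm_num at h
  have h2 : 1 ≤ (1 + 3 * r + (3 * r) ^ 2 / 2 + (3 * r) ^ 3 / 6) * (1 - 10 / 9 * r) := by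
    have e : (1 + 3 * r + (3 * r) ^ 2 / 2 + (3 * r) ^ 3 / 6) * (1 - 10 / 9 * r) =
      1 + r * (17 / 9 + 7 / 6 * r - 1 / 2 * r ^ 2 - 5 * r * r ^ 2) := by ring
    have : 0 ≤ 17 / 9 + 7 / 6 * r - 1 / 2 * r ^ 2 - 5 * r * r ^ 2 := by
      nlinarith [mul_le_mul_of_nonneg_left hr hr0.le]
    rw [e]
    nlinarith [mul_nonneg hr0.le this]
  exact h2.trans (mul_le_mul_of_nonneg_right h (by linarith))

theorem one_div_rpow_le_exp {x y c : ℝ} (hx : 0 < x) (hc : 0 ≤ c) (h : 1 / x ≤ Real.exp y) :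
    1 / x ^ c ≤ Real.exp (c * y) := by
  have h1 := Real.rpow_le_rpow (by positivity) h hc
  rwa [Real.div_rpow zero_le_one hx.le, Real.one_rpow, ← Real.exp_mul, mul_comm] at h1

theorem sum_risingCoeff_le {c r : ℝ} (hc : 0 < c) (hr0 : 0 < r) (hr1 : r < 1) (J : ℕ) :
    ∑ j ∈ Finset.range J, risingCoeff c j * r ^ j ≤ 1 / (1 - r) ^ c :=
  sum_le_hasSum _ (fun j _ => mul_nonneg (risingCoeff_pos hc j).le (by positivity))
    (hasSum_risingCoeff c (by rwa [abs_of_pos hr0]))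

theorem sum_succ_mul_risingCoeff_le {c r : ℝ} (hc : 0 < c) (hr0 : 0 < r) (hr1 : r < 1) (J : ℕ) :
    ∑ j ∈ Finset.range J, ((j : ℝ) + 1) * (risingCoeff c j * r ^ j) ≤
      1 / (1 - r) ^ c * ((1 + (c - 1) * r) / (1 - r)) := by
  have h1 := sum_risingCoeff_le hc hr0 hr1 J
  have h2 := sum_risingCoeff_le (by linarith : 0 < c + 1) hr0 hr1 J
  have h3 : ∑ j ∈ Finset.range J, (j : ℝ) * (risingCoeff c j * r ^ j) ≤
      c * r * ∑ j ∈ Finset.range J, risingCoeff (c + 1) j * r ^ j := by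
    have hle : ∑ j ∈ Finset.range J, (j : ℝ) * (risingCoeff c j * r ^ j) ≤
        ∑ j ∈ Finset.range (J + 1), (j : ℝ) * (risingCoeff c j * r ^ j) := by
      rw [Finset.sum_range_succ]
      have := mul_nonneg (risingCoeff_pos hc J).le (pow_pos hr0 J).le
      have := mul_nonneg (Nat.cast_nonneg J : (0 : ℝ) ≤ J) this
      linarith
    refine hle.trans (le_of_eq ?_)
    rw [Finset.sum_range_succ', Finset.mul_sum]
    simp only [Nat.cast_zero, zero_mul, add_zero]
    refine Finset.sum_congr rfl fun j _ => ?_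
    have := succ_mul_risingCoeff_succ_eq_mul c j
    push_cast
    rw [← mul_assoc, this, pow_succ]; ring
  have e : ∑ j ∈ Finset.range J, ((j : ℝ) + 1) * (risingCoeff c j * r ^ j) =
      ∑ j ∈ Finset.range J, (j : ℝ) * (risingCoeff c j * r ^ j) +
        ∑ j ∈ Finset.range J, risingCoeff c j * r ^ j := by
    rw [← Finset.sum_add_distrib]
    exact Finset.sum_congr rfl fun j _ => by ring
  have hpos : 0 < 1 - r := by linarith
  have h4 := h3.trans (mul_le_mul_of_nonneg_left h2 (by positivity : 0 ≤ c * r))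
  rw [e]
  refine (add_le_add h4 h1).trans (le_of_eq ?_)
  rw [Real.rpow_add_one hpos.ne']
  have := (Real.rpow_pos_of_pos hpos c).ne'
  field_simp
  ring

theorem sum_succ_mul_risingCoeff_le_exp {c r : ℝ} (hc : 0 < c) (hr0 : 0 < r) (hr : r ^ 2 ≤ 1 / 2)
    (m J : ℕ) :
    ∑ j ∈ Finset.range J, ((j : ℝ) + 1) * (risingCoeff (c + (m + 1 : ℕ)) j * r ^ j) ≤
      ((m : ℝ) + 1) * (683 / 200) ^ (m + 2) * Real.exp (3 * c * r) := by
  have hr1 : r < 70711 / 100000 := by nlinarith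
  have hpos : 0 < 1 - r := by linarith
  have hm : (0 : ℝ) ≤ m := Nat.cast_nonneg m
  have hq : 1 / (1 - r) ≤ 683 / 200 := by
    rw [div_le_iff₀ hpos]; linarith
  refine (sum_succ_mul_risingCoeff_le (by positivity) hr0 (by linarith) J).trans ?_
  rw [Real.rpow_add_natCast hpos.ne']
  have h1 : 1 / (1 - r) ^ c ≤ Real.exp (c * (2 * r)) :=
    one_div_rpow_le_exp hpos hc.le (one_div_one_sub_le_exp hr0 hr)
  have h2 : 1 + (c + (m + 1 : ℕ) - 1) * r ≤ (m + 1) * Real.exp (c * r) := by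
    have := Real.add_one_le_exp (c * r)
    push_cast
    calc 1 + (c + (m + 1) - 1) * r ≤ (m + 1) * (c * r + 1) := by
          nlinarith [mul_nonneg hm (mul_pos hc hr0).le]
      _ ≤ _ := by gcongr
  have h3 : (0 : ℝ) ≤ 1 + (c + (m + 1 : ℕ) - 1) * r := by
    push_cast
    nlinarith [mul_nonneg hm hr0.le, mul_pos hc hr0]
  calc _ = 1 / (1 - r) ^ c * (1 / (1 - r)) ^ (m + 2) * (1 + (c + (m + 1 : ℕ) - 1) * r) := by
        have := (Real.rpow_pos_of_pos hpos c).ne'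
        rw [div_pow, one_pow]
        field_simp
        ring
    _ ≤ Real.exp (c * (2 * r)) * (683 / 200) ^ (m + 2) * ((m + 1) * Real.exp (c * r)) := by
        gcongr
    _ = ((m : ℝ) + 1) * (683 / 200) ^ (m + 2) * (Real.exp (c * (2 * r)) * Real.exp (c * r)) := by
        ring
    _ = _ := by rw [← Real.exp_add]; ring_nf

theorem exists_polynomial_le_geometric (m : ℕ) :
    ∃ K : ℝ, 0 < K ∧ (m = 0 → K = 1) ∧
      ∀ l : ℕ, ((m : ℝ) + 1) * ((l : ℝ) + 2) ^ m ≤ K * (10 / 9) ^ l := by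
  rcases Nat.eq_zero_or_pos m with rfl | hm
  · refine ⟨1, one_pos, fun _ => rfl, fun l => ?_⟩
    simpa using one_le_pow₀ (by norm_num : (1 : ℝ) ≤ 10 / 9)
  · have hs := summable_pow_mul_geometric_of_norm_lt_one m
      (r := (9 / 10 : ℝ)) (by norm_num)
    set T := ∑' n : ℕ, (n : ℝ) ^ m * (9 / 10 : ℝ) ^ n with hT
    have hle : ∀ n : ℕ, (n : ℝ) ^ m * (9 / 10 : ℝ) ^ n ≤ T := fun n =>
      hs.le_tsum n fun _ _ => by positivity
    have hTpos : 0 < T := lt_of_lt_of_le (by norm_num) (hle 1)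
    refine ⟨((m : ℝ) + 1) * T * (10 / 9) ^ 2, by positivity, fun h => by omega, fun l => ?_⟩
    have h := hle (l + 2)
    have e : ((9 : ℝ) / 10) ^ (l + 2) * (10 / 9) ^ (l + 2) = 1 := by
      rw [← mul_pow]; norm_num
    push_cast at h
    calc ((m : ℝ) + 1) * ((l : ℝ) + 2) ^ m
        = ((m : ℝ) + 1) * (((l : ℝ) + 2) ^ m * (9 / 10) ^ (l + 2)) * (10 / 9) ^ (l + 2) := by
          rw [mul_assoc, mul_assoc, e, mul_one]
      _ ≤ ((m : ℝ) + 1) * T * (10 / 9) ^ (l + 2) := by gcongr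
      _ = _ := by rw [pow_add]; ring

theorem hasSum_risingCoeff_scaled_le {c r : ℝ} (hc : 0 < c) (hr0 : 0 < r) (hr : r ^ 2 ≤ 1 / 2) :
    ∃ S, HasSum (fun l => risingCoeff (c + 1) l * (10 / 9 * r) ^ l) S ∧
      S ≤ 5 * Real.exp (3 * c * r) := by
  have hr1 : r < 7072 / 10000 := by nlinarith
  have hpos : 0 < 1 - 10 / 9 * r := by linarith
  refine ⟨_, hasSum_risingCoeff (c + 1) (by rw [abs_of_pos (by positivity)]; linarith), ?_⟩
  rw [Real.rpow_add_one hpos.ne', mul_comm, ← one_div_mul_one_div]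
  have h1 := one_div_rpow_le_exp hpos hc.le (one_div_one_sub_scaled_le_exp hr0 hr)
  have h2 : 1 / (1 - 10 / 9 * r) ≤ 5 := by rw [div_le_iff₀ hpos]; linarith
  rw [show 3 * c * r = c * (3 * r) by ring]
  have := Real.rpow_pos_of_pos hpos c
  gcongr

theorem head_le {c₁ c r : ℝ} (hc0 : 0 < c₁) (hc1 : c₁ < 1) (hc : 0 < c) (hr0 : 0 < r)
    (hr : r ^ 2 ≤ 1 / 2) (m n : ℕ) :
    ∑ i ∈ Finset.range n, (risingCoeff c i * r ^ i) *
        ∑ k ∈ Finset.Ico (m + 1) (i + 1), (i.choose k : ℝ) * shiftRatio c₁ n k ≤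
      ((m + 2).factorial * ((m : ℝ) + 1) * (683 / 200) ^ (m + 2)) * Real.exp (3 * c * r) *
        ((r / n) ^ (m + 1) * ∏ j ∈ Finset.range (m + 1), (c + (j : ℝ))) := by
  have hP : 0 < ∏ j ∈ Finset.range (m + 1), (c + (j : ℝ)) :=
    Finset.prod_pos fun j _ => by positivity
  rcases lt_or_ge n (m + 2) with hn | hn
  · rw [Finset.sum_eq_zero]
    · positivity
    · intro i hi
      rw [Finset.Ico_eq_empty (by have := Finset.mem_range.1 hi; omega)]; simp
  obtain ⟨J, rfl⟩ := Nat.exists_eq_add_of_le (show m + 1 ≤ n by omega)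
  rw [Finset.sum_range_add, Finset.sum_eq_zero, zero_add]
  swap
  · intro i hi
    rw [Finset.Ico_eq_empty (by have := Finset.mem_range.1 hi; omega)]; simp
  set n := m + 1 + J with hndef
  have hn0 : (0 : ℝ) < n := by exact_mod_cast (by omega : 0 < n)
  set P := ∏ j ∈ Finset.range (m + 1), (c + (j : ℝ)) with hPdef
  have hterm : ∀ j ∈ Finset.range J, (risingCoeff c (m + 1 + j) * r ^ (m + 1 + j)) *
      ∑ k ∈ Finset.Ico (m + 1) (m + 1 + j + 1),
        ((m + 1 + j).choose k : ℝ) * shiftRatio c₁ n k ≤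
      (P * (r / n) ^ (m + 1) * (m + 2).factorial) *
        (((j : ℝ) + 1) * (risingCoeff (c + (m + 1 : ℕ)) j * r ^ j)) := by
    intro j hj
    have hj := Finset.mem_range.1 hj
    have h1 := sum_Ico_choose_mul_shiftRatio_le hc0 hc1 (m := m) (n := n) (i := m + 1 + j)
      (by omega) (by omega)
    have h2 := shiftRatio_succ_le hc0 hc1 hn
    have h3 := risingCoeff_add_mul_choose c (m + 1) j
    have h4 : ((m + 1 + j : ℕ) : ℝ) - m = j + 1 := by push_cast; ring
    rw [h4] at h1
    have hu := risingCoeff_pos hc (m + 1 + j)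
    calc _ ≤ (risingCoeff c (m + 1 + j) * r ^ (m + 1 + j)) * (((j : ℝ) + 1) *
          (((m + 1 + j).choose (m + 1) : ℝ) *
            (((m + 1).factorial : ℝ) * ((m + 2).factorial : ℝ) / (n : ℝ) ^ (m + 1)))) := by
          refine mul_le_mul_of_nonneg_left (h1.trans ?_) (by positivity)
          gcongr
      _ = (risingCoeff c (m + 1 + j) * ((m + 1 + j).choose (m + 1) : ℝ) * (m + 1).factorial) *
          (r ^ (m + 1 + j) * ((j : ℝ) + 1) * (m + 2).factorial / (n : ℝ) ^ (m + 1)) := by ring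
      _ = _ := by rw [h3, div_pow, pow_add r]; ring
  refine (Finset.sum_le_sum hterm).trans ?_
  rw [← Finset.mul_sum]
  refine (mul_le_mul_of_nonneg_left (sum_succ_mul_risingCoeff_le_exp hc hr0 hr m J)
    (by positivity)).trans (le_of_eq ?_)
  ring

theorem tail_le {c₁ c r K V : ℝ} (hc0 : 0 < c₁) (hc1 : c₁ < 1) (hc : 0 < c) (hr0 : 0 < r)
    (hr : r ^ 2 ≤ 1 / 2) {m n : ℕ} (hmn : m < n) (hK0 : 0 < K)
    (hK : ∀ l : ℕ, ((m : ℝ) + 1) * ((l : ℝ) + 2) ^ m ≤ K * (10 / 9) ^ l)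
    {A : ℕ → ℝ} (hA : ∀ i, |A i| ≤ risingCoeff c i * r ^ i)
    (hV : HasSum (fun l => A (n + l) *
      ∑ k ∈ Finset.range (m + 1), ((n + l).choose k : ℝ) * shiftRatio c₁ n k) V) :
    |V| ≤ 5 * K * Real.exp (3 * c * r) * (risingCoeff c n * r ^ n) := by
  obtain ⟨S, hS, hS5⟩ := hasSum_risingCoeff_scaled_le hc hr0 hr
  have hu := risingCoeff_pos hc n
  have hbound : ∀ l, |A (n + l) *
      ∑ k ∈ Finset.range (m + 1), ((n + l).choose k : ℝ) * shiftRatio c₁ n k| ≤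
      (risingCoeff c n * r ^ n * K) * (risingCoeff (c + 1) l * (10 / 9 * r) ^ l) := by
    intro l
    have hT0 : 0 ≤ ∑ k ∈ Finset.range (m + 1), ((n + l).choose k : ℝ) * shiftRatio c₁ n k :=
      Finset.sum_nonneg fun k hk => mul_nonneg (Nat.cast_nonneg _)
        (shiftRatio_nonneg hc0 hc1 (by have := Finset.mem_range.1 hk; omega))
    have hT : ∑ k ∈ Finset.range (m + 1), ((n + l).choose k : ℝ) * shiftRatio c₁ n k ≤
        K * (10 / 9) ^ l := by
      refine le_trans ?_ (hK l)
      have : ∀ k ∈ Finset.range (m + 1),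
          ((n + l).choose k : ℝ) * shiftRatio c₁ n k ≤ ((l : ℝ) + 2) ^ m := fun k hk => by
        have hk := Finset.mem_range.1 hk
        refine (choose_mul_shiftRatio_le_pow hc0 hc1 (by omega) l).trans ?_
        exact pow_le_pow_right₀ (by linarith [(Nat.cast_nonneg l : (0 : ℝ) ≤ l)]) (by omega)
      refine (Finset.sum_le_card_nsmul _ _ _ this).trans ?_
      simp
    have hu1 := risingCoeff_pos (by linarith : 0 < c + 1) l
    rw [abs_mul, abs_of_nonneg hT0]
    calc _ ≤ (risingCoeff c n * risingCoeff (c + 1) l * r ^ (n + l)) * (K * (10 / 9) ^ l) := by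
          refine mul_le_mul ((hA _).trans ?_) hT hT0 (by positivity)
          exact mul_le_mul_of_nonneg_right (risingCoeff_add_le hc n l) (by positivity)
      _ = _ := by rw [pow_add, mul_pow]; ring
  have hS' := hS.mul_left (risingCoeff c n * r ^ n * K)
  have h := tsum_of_norm_bounded (f := fun l => A (n + l) *
    ∑ k ∈ Finset.range (m + 1), ((n + l).choose k : ℝ) * shiftRatio c₁ n k) hS' hbound
  rw [hV.tsum_eq, Real.norm_eq_abs] at h
  refine h.trans ((mul_le_mul_of_nonneg_left hS5 (by positivity)).trans (le_of_eq ?_))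
  ring

theorem error_le {c₁ c r K V : ℝ} (hc0 : 0 < c₁) (hc1 : c₁ < 1) (hc : 0 < c) (hr0 : 0 < r)
    (hr : r ^ 2 ≤ 1 / 2) {m n : ℕ} (hmn : m < n) (hK0 : 0 < K)
    (hK : ∀ l : ℕ, ((m : ℝ) + 1) * ((l : ℝ) + 2) ^ m ≤ K * (10 / 9) ^ l)
    {A : ℕ → ℝ} (hA : ∀ i, |A i| ≤ risingCoeff c i * r ^ i)
    (hV : HasSum (fun i => A i *
      ∑ k ∈ Finset.range (m + 1), (i.choose k : ℝ) * shiftRatio c₁ n k) V) :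
    |∑ i ∈ Finset.range (n + 1), A i * (risingCoeff c₁ (n - i) / risingCoeff c₁ n) - V| ≤
      Real.exp (3 * c * r) *
        (((m + 2).factorial * ((m : ℝ) + 1) * (683 / 200) ^ (m + 2)) *
            ((r / n) ^ (m + 1) * ∏ j ∈ Finset.range (m + 1), (c + (j : ℝ))) +
          (1 + 5 * K) * (risingCoeff c n * (4 * (n : ℝ) ^ 2 / c₁) * r ^ n)) := by
  set T : ℕ → ℝ := fun i => ∑ k ∈ Finset.range (m + 1), (i.choose k : ℝ) * shiftRatio c₁ n k
    with hTdef
  have hTnonneg : ∀ i, 0 ≤ T i := fun i => Finset.sum_nonneg fun k hk =>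
    mul_nonneg (Nat.cast_nonneg _)
      (shiftRatio_nonneg hc0 hc1 (by have := Finset.mem_range.1 hk; omega))
  have hn1 : (1 : ℝ) ≤ n := by exact_mod_cast (by omega : 1 ≤ n)
  have hu := risingCoeff_pos hc n
  have hu1 := risingCoeff_pos hc0 n
  have htail : HasSum (fun l => A (n + l) * T (n + l)) (V - ∑ i ∈ Finset.range n, A i * T i) := by
    have := (hasSum_nat_add_iff' n).2 hV
    simpa only [add_comm n] using this
  have h3 := tail_le hc0 hc1 hc hr0 hr hmn hK0 hK hA htail
  have hdiff : ∀ i ∈ Finset.range n, |A i * (risingCoeff c₁ (n - i) / risingCoeff c₁ n) - A i * T i| ≤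
      (risingCoeff c i * r ^ i) *
        ∑ k ∈ Finset.Ico (m + 1) (i + 1), (i.choose k : ℝ) * shiftRatio c₁ n k := by
    intro i hi
    have hi := Finset.mem_range.1 hi
    have hnn : 0 ≤ ∑ k ∈ Finset.Ico (m + 1) (i + 1), (i.choose k : ℝ) * shiftRatio c₁ n k :=
      Finset.sum_nonneg fun k hk => mul_nonneg (Nat.cast_nonneg _)
        (shiftRatio_nonneg hc0 hc1 (by have := Finset.mem_Ico.1 hk; omega))
    have he : risingCoeff c₁ (n - i) / risingCoeff c₁ n - T i =
        ∑ k ∈ Finset.Ico (m + 1) (i + 1), (i.choose k : ℝ) * shiftRatio c₁ n k := by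
      rw [risingCoeff_sub_div hc0 hi.le, hTdef]
      rcases le_total m i with hmi | hmi
      · rw [Finset.sum_Ico_eq_sub _ (by omega)]
      · rw [Finset.Ico_eq_empty_of_le (by omega), Finset.sum_empty, sub_eq_zero]
        refine Finset.sum_subset (Finset.range_mono (by omega)) fun k _ hk => ?_
        rw [Nat.choose_eq_zero_of_lt (by simpa using hk)]; simp
    rw [← mul_sub, abs_mul, he, abs_of_nonneg hnn]
    exact mul_le_mul_of_nonneg_right (hA i) hnn
  have h1 : |∑ i ∈ Finset.range n, (A i * (risingCoeff c₁ (n - i) / risingCoeff c₁ n) - A i * T i)| ≤ _ :=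
    (Finset.abs_sum_le_sum_abs _ _).trans
      ((Finset.sum_le_sum hdiff).trans (head_le hc0 hc1 hc hr0 hr m n))
  have h2 : |A n * (risingCoeff c₁ (n - n) / risingCoeff c₁ n)| ≤
      (risingCoeff c n * r ^ n) * (n / c₁) := by
    rw [Nat.sub_self, risingCoeff_zero, abs_mul,
      abs_of_pos (show 0 < 1 / risingCoeff c₁ n by positivity)]
    refine mul_le_mul (hA n) ?_ (by positivity) (by positivity)
    rw [← one_div_div c₁]
    exact one_div_le_one_div_of_le (by positivity) (div_le_risingCoeff hc0 (by omega))
  have hsplit : ∑ i ∈ Finset.range (n + 1), A i * (risingCoeff c₁ (n - i) / risingCoeff c₁ n) - V =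
      ∑ i ∈ Finset.range n, (A i * (risingCoeff c₁ (n - i) / risingCoeff c₁ n) - A i * T i) +
        A n * (risingCoeff c₁ (n - n) / risingCoeff c₁ n) -
        (V - ∑ i ∈ Finset.range n, A i * T i) := by
    rw [Finset.sum_range_succ, Finset.sum_sub_distrib]; ring
  rw [hsplit]
  refine (abs_sub _ _).trans ((add_le_add ((abs_add_le _ _).trans (add_le_add h1 h2)) h3).trans ?_)
  set e := Real.exp (3 * c * r)
  have he1 : 1 ≤ e := Real.one_le_exp (by positivity)
  set M := risingCoeff c n * r ^ n with hM
  have hMpos : 0 < M := by positivity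
  have hY : risingCoeff c n * (4 * (n : ℝ) ^ 2 / c₁) * r ^ n = M * (4 * (n : ℝ) ^ 2 / c₁) := by
    rw [hM]; ring
  have hq : (n : ℝ) / c₁ ≤ 4 * (n : ℝ) ^ 2 / c₁ := by gcongr; nlinarith
  have hq1 : (1 : ℝ) ≤ 4 * (n : ℝ) ^ 2 / c₁ := by
    rw [le_div_iff₀ hc0]; nlinarith
  rw [hY]
  have i1 : M * (n / c₁) ≤ e * (M * (4 * (n : ℝ) ^ 2 / c₁)) :=
    (mul_le_mul_of_nonneg_left hq hMpos.le).trans (le_mul_of_one_le_left (by positivity) he1)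
  have i2 : 5 * K * e * M ≤ 5 * K * e * (M * (4 * (n : ℝ) ^ 2 / c₁)) :=
    mul_le_mul_of_nonneg_left (le_mul_of_one_le_right hMpos.le hq1) (by positivity)
  linarith

/-- Theorem on coefficients of products of power series with distinct radii of convergence.
Fix `m ≥ 0`. There is a constant `C_m` depending only on `m` (with `C₀ = 24`) such that:
for `0 < β < α` with `r = β/α ≤ 1/√2`, `c₁ ∈ (0,1)`, `c₂ > 0`, a sequence `ã` with
`|ãₙ| ≤ c₂/αⁿ` for `n ≥ 1`, `a(x) = exp(∑_{n≥1} ãₙ xⁿ/n)` with coefficients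
`aᵢ = a⁽ⁱ⁾(0)/i!`, and `bₙ = β⁻ⁿ·binom(n+c₁−1,n)` the coefficients of `(1−x/β)^{−c₁}`:
for all `n > m`, writing `fₙ = ∑_{i≤n} aᵢ b_{n−i} = bₙ(a(β) + ∑_{k=1}^m … + E)`, one has
`|E| ≤ C_m·exp(3c₂r)·((r/n)^{m+1}(c₂+m)_{m+1} + binom(n+c₂−1,n)·(4n²/c₁)·rⁿ)`. -/
theorem coeff_product_asymptotics (m : ℕ) :
    ∃ Cm : ℝ, 0 < Cm ∧ (m = 0 → Cm = 24) ∧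
      ∀ (α β c₁ c₂ : ℝ) (ta : ℕ → ℝ) (a : ℝ → ℝ),
        0 < β → β < α → β / α ≤ 1 / Real.sqrt 2 →
        c₁ ∈ Set.Ioo (0 : ℝ) 1 → 0 < c₂ →
        (∀ k : ℕ, 1 ≤ k → |ta k| ≤ c₂ / α ^ k) →
        (∀ x : ℝ, a x = Real.exp (∑' k : ℕ, ta (k + 1) * x ^ (k + 1) / ((k : ℝ) + 1))) →
        ∀ n : ℕ, m < n →
          |(∑ i ∈ Finset.range (n + 1),
                (iteratedDeriv i a 0 / (Nat.factorial i : ℝ)) *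
                  (β⁻¹ ^ (n - i) * rbinom (((n - i : ℕ) : ℝ) + c₁ - 1) (n - i))) /
              (β⁻¹ ^ n * rbinom ((n : ℝ) + c₁ - 1) n) -
            (a β + ∑ k ∈ Finset.Icc 1 m,
              (rbinom ((k : ℝ) - c₁) k / rbinom ((n : ℝ) + c₁ - 1) k) *
                (β ^ k / (Nat.factorial k : ℝ)) * iteratedDeriv k a β)| ≤
          Cm * Real.exp (3 * c₂ * (β / α)) *
            (((β / α) / n) ^ (m + 1) * ffall (c₂ + m) (m + 1) +
              rbinom ((n : ℝ) + c₂ - 1) n * (4 * (n : ℝ) ^ 2 / c₁) * (β / α) ^ n) := by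
  obtain ⟨K, hK0, hK1, hK⟩ := exists_polynomial_le_geometric m
  set P : ℝ := (m + 2).factorial * ((m : ℝ) + 1) * (683 / 200) ^ (m + 2) with hP
  have hP0 : 0 < P := by positivity
  obtain ⟨C, hC0, hC24, hPC, hQC⟩ : ∃ C : ℝ, 0 < C ∧ (m = 0 → C = 24) ∧ P ≤ C ∧ 1 + 5 * K ≤ C := by
    rcases Nat.eq_zero_or_pos m with rfl | hm
    · refine ⟨24, by norm_num, fun _ => rfl, ?_, ?_⟩
      · rw [hP]; norm_num [Nat.factorial]
      · rw [hK1 rfl]; norm_num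
    · exact ⟨P + (1 + 5 * K), by positivity, fun h => by omega, by linarith, by linarith⟩
  refine ⟨C, hC0, hC24, ?_⟩
  intro α β c₁ c₂ ta a hβ hβα hr hc₁ hc₂ hta ha n hmn
  have hα : 0 < α := hβ.trans hβα
  obtain ⟨hc0, hc1⟩ := hc₁
  set r := β / α with hrdef
  have hr0 : 0 < r := div_pos hβ hα
  have hr2 : r ^ 2 ≤ 1 / 2 := by
    calc r ^ 2 ≤ (1 / Real.sqrt 2) ^ 2 := by gcongr
      _ = 1 / 2 := by rw [div_pow, Real.sq_sqrt (by norm_num)]; norm_num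
  have hasum : ∀ x, |x| < α → HasSum (fun i => expCoeff ta i * x ^ i) (a x) := fun x hx => by
    rw [ha]; exact hasSum_exp_of_abs_le hα hc₂ hta hx
  have hβabs : |β| < α := by rwa [abs_of_pos hβ]
  set A : ℕ → ℝ := fun i => expCoeff ta i * β ^ i with hAdef
  have hA : ∀ i, |A i| ≤ risingCoeff c₂ i * r ^ i := fun i => by
    rw [hAdef, abs_mul, abs_of_pos (pow_pos hβ i), hrdef, div_pow, mul_div_assoc',
      mul_div_right_comm]
    gcongr
    exact abs_expCoeff_le hta i
  have hV : HasSum (fun i => A i *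
      ∑ k ∈ Finset.range (m + 1), (i.choose k : ℝ) * shiftRatio c₁ n k)
      (∑ k ∈ Finset.range (m + 1), shiftRatio c₁ n k *
        (β ^ k / (Nat.factorial k : ℝ) * iteratedDeriv k a β)) := by
    refine (hasSum_congr_term fun i => ?_).2 (hasSum_sum fun k _ =>
      (hasSum_choose_iteratedDeriv hasum k hβabs).mul_left (shiftRatio c₁ n k))
    rw [Finset.mul_sum]
    exact Finset.sum_congr rfl fun k _ => by rw [hAdef]; ring
  have h := error_le hc0 hc1 hc₂ hr0 hr2 hmn hK0 hK hA hV
  have e1 : (∑ i ∈ Finset.range (n + 1),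
      (iteratedDeriv i a 0 / (Nat.factorial i : ℝ)) *
        (β⁻¹ ^ (n - i) * rbinom (((n - i : ℕ) : ℝ) + c₁ - 1) (n - i))) /
      (β⁻¹ ^ n * rbinom ((n : ℝ) + c₁ - 1) n) =
      ∑ i ∈ Finset.range (n + 1), A i * (risingCoeff c₁ (n - i) / risingCoeff c₁ n) := by
    rw [Finset.sum_div]
    refine Finset.sum_congr rfl fun i hi => ?_
    have hi' : i ≤ n := Nat.lt_succ_iff.1 (Finset.mem_range.1 hi)
    rw [rbinom_add_sub_one, rbinom_add_sub_one, iteratedDeriv_zero_div_factorial hα hasum, hAdef]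
    have hpow : β⁻¹ ^ n = β⁻¹ ^ (n - i) * β⁻¹ ^ i := by rw [← pow_add, Nat.sub_add_cancel hi']
    have hu := (risingCoeff_pos hc0 n).ne'
    rw [hpow, inv_pow, inv_pow]
    field_simp
  have e2 : a β + ∑ k ∈ Finset.Icc 1 m,
      (rbinom ((k : ℝ) - c₁) k / rbinom ((n : ℝ) + c₁ - 1) k) *
        (β ^ k / (Nat.factorial k : ℝ)) * iteratedDeriv k a β =
      ∑ k ∈ Finset.range (m + 1), shiftRatio c₁ n k *
        (β ^ k / (Nat.factorial k : ℝ) * iteratedDeriv k a β) := by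
    have hI : Finset.Icc 1 m = Finset.Ico 1 (m + 1) := by ext; simp
    rw [Finset.range_eq_Ico, Finset.sum_eq_sum_Ico_succ_bot (by omega), hI]
    congr 1
    · simp [shiftRatio]
    · exact Finset.sum_congr rfl fun k _ => by rw [rbinom_div_rbinom, mul_assoc]
  rw [e1, e2, ffall_add_succ, rbinom_add_sub_one, mul_comm C, mul_assoc]
  refine h.trans (mul_le_mul_of_nonneg_left ?_ (Real.exp_pos _).le)
  have hu := risingCoeff_pos hc₂ n
  have hprod : 0 < ∏ j ∈ Finset.range (m + 1), (c₂ + (j : ℝ)) :=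
    Finset.prod_pos fun j _ => by positivity
  rw [mul_add C]
  exact add_le_add (mul_le_mul_of_nonneg_right hPC (by positivity))
    (mul_le_mul_of_nonneg_right hQC (by positivity))
end

section
/- Under the stated hypotheses, for every integer n with n ≥ max{ 5·((2c₂+4)/ln(1/r) + 1)·ln((2c₂+4)/ln(1/r) + 1) + 1 , 2·ln(1/c₁)/ln(1/r) + 1 }, one has |fₙ/bₙ − a(β)| ≤ 48 · exp(3c₂r) · c₂ r / n. -/
open Finset in
lemma Ring.factorial_mul_multichoose_eq_prod (c : ℝ) (n : ℕ) :
    (n.factorial : ℝ) * Ring.multichoose c n = ∏ i ∈ range n, (c + i) := by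
  rw [← nsmul_eq_mul, Ring.factorial_nsmul_multichoose_eq_ascPochhammer,
    Polynomial.ascPochhammer_smeval_eq_eval]
  induction n with
  | zero => simp
  | succ n ih => rw [ascPochhammer_succ_eval, ih, prod_range_succ]

lemma Ring.succ_mul_multichoose_succ (c : ℝ) (n : ℕ) :
    ((n : ℝ) + 1) * Ring.multichoose c (n + 1) = (c + n) * Ring.multichoose c n := by
  have h := Ring.factorial_mul_multichoose_eq_prod c (n + 1)
  rw [Finset.prod_range_succ, ← Ring.factorial_mul_multichoose_eq_prod, Nat.factorial_succ] at h
  push_cast at h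
  have hn : (n.factorial : ℝ) ≠ 0 := by positivity
  apply mul_left_cancel₀ hn
  linarith

lemma Ring.succ_mul_multichoose_succ' (c : ℝ) (n : ℕ) :
    ((n : ℝ) + 1) * Ring.multichoose c (n + 1) = c * Ring.multichoose (c + 1) n := by
  induction n with
  | zero => simp
  | succ n ih =>
    have h1 := Ring.succ_mul_multichoose_succ c (n + 1)
    have h2 := Ring.succ_mul_multichoose_succ (c + 1) n
    have hn : (n : ℝ) + 1 ≠ 0 := by positivity
    apply mul_left_cancel₀ hn
    push_cast at h1 ⊢
    linear_combination (n + 1 : ℝ) * h1 + (c + (n + 1)) * ih - c * h2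

lemma Ring.sum_multichoose (c : ℝ) (n : ℕ) :
    ∑ k ∈ Finset.range (n + 1), Ring.multichoose c k = Ring.multichoose (c + 1) n := by
  induction n with
  | zero => simp
  | succ n ih => rw [Finset.sum_range_succ, ih, Ring.multichoose_succ_succ, add_comm]

lemma Ring.multichoose_pos {c : ℝ} (hc : 0 < c) (n : ℕ) : 0 < Ring.multichoose c n := by
  have h := Ring.factorial_mul_multichoose_eq_prod c n
  have hp : 0 < ∏ i ∈ Finset.range n, (c + i) := Finset.prod_pos fun i _ => by positivity
  rw [← h] at hp
  exact pos_of_mul_pos_right hp (by positivity)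

lemma rbinom_eq_multichoose (c : ℝ) (n : ℕ) :
    rbinom ((n : ℝ) + c - 1) n = Ring.multichoose c n := by
  have hn : (n.factorial : ℝ) ≠ 0 := by positivity
  rw [rbinom, div_eq_iff hn, mul_comm, Ring.factorial_mul_multichoose_eq_prod,
    ← Finset.prod_range_reflect]
  refine Finset.prod_congr rfl fun i hi => ?_
  have hi := Finset.mem_range.1 hi
  rw [Nat.sub_sub, Nat.cast_sub (by omega)]
  push_cast
  ring

lemma hasSum_multichoose_mul_pow (c : ℝ) {x : ℝ} (hx : |x| < 1) :
    HasSum (fun n => Ring.multichoose c n * x ^ n) (1 / (1 - x) ^ c) := by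
  have h := (Real.one_div_one_sub_rpow_hasFPowerSeriesOnBall_zero c).hasSum (y := x)
    (by simpa [enorm_eq_nnnorm, ← NNReal.coe_lt_one] using hx)
  simpa [Ring.multichoose_eq, mul_comm] using h

lemma Ring.multichoose_add_one_le_exp {c : ℝ} (hc : 0 < c) {k n : ℕ} (hkn : k ≤ n) (hn : 1 ≤ n) :
    Ring.multichoose (c + 1) k ≤ Real.exp (c * (1 + Real.log n)) := by
  have h : ∀ k : ℕ, Ring.multichoose (c + 1) k ≤ Real.exp (c * (harmonic k : ℝ)) := by
    intro k
    induction k with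
    | zero => simp
    | succ k ih =>
      have h1 := Ring.succ_mul_multichoose_succ (c + 1) k
      have hk : (0 : ℝ) < k + 1 := by positivity
      have h2 : Ring.multichoose (c + 1) (k + 1)
          = (c / (k + 1) + 1) * Ring.multichoose (c + 1) k := by
        field_simp
        linarith
      rw [h2, harmonic_succ]
      push_cast
      rw [mul_add, add_comm (c * _), Real.exp_add]
      have := Real.add_one_le_exp (c / (k + 1))
      rw [div_eq_mul_inv] at this ⊢
      exact mul_le_mul this ih (Ring.multichoose_pos (by linarith) _).le (Real.exp_pos _).le
  refine (h k).trans ?_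
  gcongr
  refine (harmonic_le_one_add_log k).trans ?_
  rcases Nat.eq_zero_or_pos k with rfl | hk
  · simpa using Real.log_nonneg (by exact_mod_cast hn)
  · gcongr

lemma hasDerivAt_tsum_mul_pow_succ_div {v : ℕ → ℝ} {R x : ℝ}
    (hv : ∀ ρ, 0 < ρ → ρ < R → Summable fun k => |v k| * ρ ^ k) (hx : |x| < R) :
    HasDerivAt (fun y => ∑' k : ℕ, v k * y ^ (k + 1) / ((k : ℝ) + 1)) (∑' k, v k * x ^ k) x := by
  obtain ⟨ρ, hxρ, hρR⟩ := exists_between hx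
  have hρ : 0 < ρ := (abs_nonneg x).trans_lt hxρ
  refine hasDerivAt_tsum_of_isPreconnected (F := ℝ) (t := Set.Ioo (-ρ) ρ) (y₀ := (0 : ℝ))
    (g' := fun k y => v k * y ^ k) (hv ρ hρ hρR)
    isOpen_Ioo isPreconnected_Ioo (fun k y _ => ?_) (fun k y hy => ?_) (by simpa using hρ) ?_
    (abs_lt.1 hxρ)
  · have h := ((hasDerivAt_pow (k + 1) y).const_mul (v k)).div_const ((k : ℝ) + 1)
    refine h.congr_deriv ?_
    have : (k : ℝ) + 1 ≠ 0 := by positivity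
    rw [div_eq_iff this, Nat.add_sub_cancel]
    push_cast
    ring
  · rw [Real.norm_eq_abs, abs_mul, abs_pow]
    gcongr
    exact (abs_lt.2 hy).le
  · simp

/-- Taylor coefficients of `exp (∑ u k * x ^ (k + 1) / (k + 1))`. -/
noncomputable def expSeriesCoeff (u : ℕ → ℝ) : ℕ → ℝ
  | 0 => 1
  | n + 1 => (∑ k : Fin (n + 1), expSeriesCoeff u k * u (n - k)) / ((n : ℝ) + 1)
decreasing_by exact k.2

lemma expSeriesCoeff_zero (u : ℕ → ℝ) : expSeriesCoeff u 0 = 1 := by rw [expSeriesCoeff]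

lemma succ_mul_expSeriesCoeff_succ (u : ℕ → ℝ) (n : ℕ) :
    ((n : ℝ) + 1) * expSeriesCoeff u (n + 1)
      = ∑ k ∈ Finset.range (n + 1), expSeriesCoeff u k * u (n - k) := by
  have hn : (n : ℝ) + 1 ≠ 0 := by positivity
  rw [expSeriesCoeff, mul_div_cancel₀ _ hn,
    Finset.sum_range fun k => expSeriesCoeff u k * u (n - k)]

lemma abs_expSeriesCoeff_le {u : ℕ → ℝ} {c α : ℝ}
    (hu : ∀ k, |u k| ≤ c / α ^ (k + 1)) (n : ℕ) :
    |expSeriesCoeff u n| ≤ Ring.multichoose c n / α ^ n := by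
  induction n using Nat.strong_induction_on with
  | _ n ih =>
    rcases n with _ | n
    · simp [expSeriesCoeff_zero]
    · have hn : (0 : ℝ) < n + 1 := by positivity
      refine le_of_mul_le_mul_left ?_ hn
      rw [← abs_of_pos hn, ← abs_mul, succ_mul_expSeriesCoeff_succ, abs_of_pos hn, ← mul_div_assoc,
        Ring.succ_mul_multichoose_succ', ← Ring.sum_multichoose, Finset.mul_sum, Finset.sum_div]
      refine (Finset.abs_sum_le_sum_abs _ _).trans (Finset.sum_le_sum fun k hk => ?_)
      have hk := Finset.mem_range.1 hk
      rw [abs_mul]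
      calc _ ≤ (Ring.multichoose c k / α ^ k) * (c / α ^ (n - k + 1)) :=
            mul_le_mul (ih k hk) (hu _) (abs_nonneg _) ((abs_nonneg _).trans (ih k hk))
        _ = _ := by
            rw [div_mul_div_comm, ← pow_add, mul_comm c]
            congr 2
            omega

section ExpSeries

variable {u : ℕ → ℝ} {c α : ℝ}

lemma summable_abs_expSeriesCoeff_mul_pow (hα : 0 < α)
    (hu : ∀ k, |u k| ≤ c / α ^ (k + 1)) {ρ : ℝ} (h0 : 0 ≤ ρ) (hρ : ρ < α) :
    Summable fun n => |expSeriesCoeff u n| * ρ ^ n := by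
  have h1 : |ρ / α| < 1 := by rw [abs_of_nonneg (by positivity)]; exact (div_lt_one hα).2 hρ
  refine (hasSum_multichoose_mul_pow c h1).summable.of_nonneg_of_le (fun n => by positivity)
    fun n => ?_
  rw [div_pow, ← mul_div_assoc, mul_div_right_comm]
  gcongr
  exact abs_expSeriesCoeff_le hu n

lemma hasSum_expSeriesCoeff_mul_pow (hα : 0 < α)
    (hu : ∀ k, |u k| ≤ c / α ^ (k + 1)) {x : ℝ} (hx : |x| < α) :
    HasSum (fun n => expSeriesCoeff u n * x ^ n)
      (Real.exp (∑' k : ℕ, u k * x ^ (k + 1) / ((k : ℝ) + 1))) := by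
  set A := expSeriesCoeff u
  have hsu : ∀ ρ, 0 ≤ ρ → ρ < α → Summable fun k => |u k| * ρ ^ k := by
    intro ρ h0 h1
    have h2 : ρ / α < 1 := (div_lt_one hα).2 h1
    refine ((summable_geometric_of_lt_one (by positivity) h2).mul_left (c / α)).of_nonneg_of_le
      (fun n => by positivity) fun n => ?_
    calc |u n| * ρ ^ n ≤ c / α ^ (n + 1) * ρ ^ n := by gcongr; exact hu n
      _ = _ := by rw [div_pow, pow_succ]; field_simp
  have hsA : ∀ ρ, 0 ≤ ρ → ρ < α → Summable fun k => |A k| * ρ ^ k := fun ρ h0 h1 =>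
    summable_abs_expSeriesCoeff_mul_pow hα hu h0 h1
  have hsA' : ∀ y, |y| < α → Summable fun k => A k * y ^ k := fun y hy =>
    Summable.of_norm (by simpa [abs_mul] using hsA |y| (abs_nonneg y) hy)
  have hsv : ∀ ρ, 0 < ρ → ρ < α → Summable fun k : ℕ => |((k : ℝ) + 1) * A (k + 1)| * ρ ^ k := by
    intro ρ h0 h1
    have h2 : |ρ / α| < 1 := by rw [abs_of_nonneg (by positivity)]; exact (div_lt_one hα).2 h1
    refine ((hasSum_multichoose_mul_pow (c + 1) h2).summable.mul_left (c / α)).of_nonneg_of_le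
      (fun n => by positivity) fun n => ?_
    rw [abs_mul, abs_of_nonneg (by positivity : (0 : ℝ) ≤ (n : ℝ) + 1)]
    calc _ ≤ ((n : ℝ) + 1) * (Ring.multichoose c (n + 1) / α ^ (n + 1)) * ρ ^ n := by
          gcongr
          exact abs_expSeriesCoeff_le hu (n + 1)
      _ = _ := by
          rw [← mul_div_assoc, Ring.succ_mul_multichoose_succ', div_pow, pow_succ]
          field_simp
  set g : ℝ → ℝ := fun y => ∑' k : ℕ, u k * y ^ (k + 1) / ((k : ℝ) + 1)
  set F : ℝ → ℝ := fun y =>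
    1 + ∑' k : ℕ, (((k : ℝ) + 1) * A (k + 1)) * y ^ (k + 1) / ((k : ℝ) + 1)
  have hF : ∀ y, |y| < α → HasSum (fun n => A n * y ^ n) (F y) := by
    intro y hy
    have h := (hsA' y hy).hasSum
    rwa [(hsA' y hy).tsum_eq_zero_add, pow_zero, mul_one,
      show A 0 = 1 from expSeriesCoeff_zero u, show (fun k => A (k + 1) * y ^ (k + 1)) =
        fun k : ℕ => (((k : ℝ) + 1) * A (k + 1)) * y ^ (k + 1) / ((k : ℝ) + 1) by
        ext k
        have : (k : ℝ) + 1 ≠ 0 := by positivity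
        field_simp] at h
  have hg' : ∀ y, |y| < α → HasDerivAt g (∑' k, u k * y ^ k) y := fun y hy =>
    hasDerivAt_tsum_mul_pow_succ_div (fun ρ h0 h1 => hsu ρ h0.le h1) hy
  have hF' : ∀ y, |y| < α → HasDerivAt F (F y * ∑' k, u k * y ^ k) y := by
    intro y hy
    refine ((hasDerivAt_tsum_mul_pow_succ_div hsv hy).const_add 1).congr_deriv ?_
    symm
    rw [← (hF y hy).tsum_eq, tsum_mul_tsum_eq_tsum_sum_range_of_summable_norm
      (by simpa [abs_mul] using hsA |y| (abs_nonneg y) hy)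
      (by simpa [abs_mul] using hsu |y| (abs_nonneg y) hy)]
    refine tsum_congr fun n => ?_
    rw [succ_mul_expSeriesCoeff_succ, Finset.sum_mul]
    refine Finset.sum_congr rfl fun k hk => ?_
    have hk := Finset.mem_range.1 hk
    rw [show y ^ n = y ^ k * y ^ (n - k) by rw [← pow_add]; congr 1; omega]
    ring
  have hD : ∀ y ∈ Metric.ball (0 : ℝ) α, HasDerivAt (fun z => F z * Real.exp (-g z)) 0 y := by
    intro y hy
    have hy : |y| < α := by simpa using hy
    refine ((hF' y hy).mul (hg' y hy).neg.exp).congr_deriv ?_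
    simp only [Pi.neg_apply]
    ring
  have hconst := Metric.isOpen_ball.is_const_of_deriv_eq_zero
    (convex_ball (0 : ℝ) α).isPreconnected
    (fun y hy => (hD y hy).differentiableAt.differentiableWithinAt)
    (fun y hy => (hD y hy).deriv) (x := x) (y := 0) (by simpa using hx) (by simpa using hα)
  have h0 : F 0 * Real.exp (-g 0) = 1 := by simp [F, g]
  have hFx : F x = Real.exp (g x) := by
    rw [h0, Real.exp_neg, ← div_eq_mul_inv] at hconst
    exact eq_of_div_eq_one hconst
  have := hF x hx
  rwa [hFx] at this

end ExpSeries

lemma iteratedDeriv_div_factorial_eq_of_hasSum {f : ℝ → ℝ} {A : ℕ → ℝ} {R : ℝ} (hR : 0 < R)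
    (hf : ∀ x, |x| < R → HasSum (fun n => A n * x ^ n) (f x)) (i : ℕ) :
    iteratedDeriv i f 0 / (i.factorial : ℝ) = A i := by
  have h : HasFPowerSeriesAt f (FormalMultilinearSeries.ofScalars ℝ A) 0 := by
    rw [hasFPowerSeriesAt_iff]
    filter_upwards [Metric.ball_mem_nhds (0 : ℝ) hR] with x hx
    simpa [mul_comm, FormalMultilinearSeries.coeff_ofScalars] using hf x (by simpa using hx)
  have h2 := (AnalyticAt.hasFPowerSeriesAt h.analyticAt).eq_formalMultilinearSeries h
  have h3 := congrArg (fun p => p.coeff i) h2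
  simpa [FormalMultilinearSeries.coeff_ofScalars] using h3

lemma Ring.mul_multichoose_le_mul_multichoose {c : ℝ} (hc : 0 < c) {k n : ℕ} (hkn : k ≤ n) :
    (k : ℝ) * Ring.multichoose c k ≤ n * Ring.multichoose c n := by
  induction n, hkn using Nat.le_induction with
  | base => exact le_rfl
  | succ n hn ih =>
    have h := Ring.succ_mul_multichoose_succ c n
    have := mul_pos hc (Ring.multichoose_pos hc n)
    push_cast
    linarith

lemma Ring.multichoose_antitone {c : ℝ} (hc : 0 < c) (hc1 : c ≤ 1) :
    Antitone (Ring.multichoose c) := by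
  refine antitone_nat_of_succ_le fun n => ?_
  have h := Ring.succ_mul_multichoose_succ c n
  have hn : (0 : ℝ) < n + 1 := by positivity
  refine le_of_mul_le_mul_left ?_ hn
  rw [h]
  exact mul_le_mul_of_nonneg_right (by linarith) (Ring.multichoose_pos hc n).le

lemma exp_neg_three_mul_le_one_sub {r : ℝ} (h0 : 0 ≤ r) (h : r ≤ 1 / √2) :
    Real.exp (-(3 * r)) ≤ 1 - r := by
  have hr : r ^ 2 ≤ 1 / 2 := by
    calc r ^ 2 ≤ (1 / √2) ^ 2 := by gcongr
      _ = 1 / 2 := by rw [div_pow, Real.sq_sqrt (by norm_num), one_pow]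
  have h1 : r < 3 / 4 := by nlinarith
  have h2 := Real.quadratic_le_exp_of_nonneg (x := 3 * r) (by linarith)
  rw [Real.exp_neg, inv_le_iff_one_le_mul₀ (Real.exp_pos _)]
  nlinarith [mul_nonneg h0 h0]

lemma sub_one_mul_log_le {M y : ℝ} (hM : 1 < M) (hy : 5 * M * Real.log M ≤ y) :
    (M - 1) * Real.log (y + 1) ≤ y / 2 := by
  have hM0 : 0 < M := by linarith
  have hlog : 0 < Real.log M := Real.log_pos hM
  have hy0 : 0 < y := lt_of_lt_of_le (by positivity) hy
  have hlow := Real.le_log_one_add_of_nonneg (x := M - 1) (by linarith)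
  rw [show 1 + (M - 1) = M by ring, div_le_iff₀ (by linarith)] at hlow
  have hup : Real.log (y + 1) ≤ (y + 1) / (4 * M) - 1 + (2 * Real.log 2 + Real.log M) := by
    have h1 := Real.log_le_sub_one_of_pos (x := (y + 1) / (4 * M)) (by positivity)
    rw [Real.log_div (by positivity) (by positivity), Real.log_mul (by norm_num) hM0.ne',
      show (4 : ℝ) = 2 ^ 2 by norm_num, Real.log_pow] at h1
    push_cast at h1
    linarith
  have hl2 := Real.log_two_lt_d9
  have h3 : (M - 1) * Real.log (y + 1) ≤
      (M - 1) * ((y + 1) / (4 * M) + 0.4 + Real.log M) :=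
    mul_le_mul_of_nonneg_left (by linarith) (by linarith)
  refine h3.trans ?_
  have h4 : (M - 1) * ((y + 1) / (4 * M)) = (y + 1) / 4 - (y + 1) / (4 * M) := by
    field_simp
  have h5 : 5 / 4 * Real.log M ≤ y / (4 * M) := by
    rw [le_div_iff₀ (by positivity)]; linarith
  have h6 : (y + 1) / (4 * M) = y / (4 * M) + M⁻¹ / 4 := by field_simp
  nlinarith

lemma two_mul_exp_le {c₁ c₂ r : ℝ} {n : ℕ} (hr0 : 0 < r) (hr1 : r < 1) (hc₁ : 0 < c₁)
    (hc₂ : 0 < c₂)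
    (h1 : 5 * ((2 * c₂ + 4) / Real.log (1 / r) + 1) *
      Real.log ((2 * c₂ + 4) / Real.log (1 / r) + 1) + 1 ≤ n)
    (h2 : 2 * Real.log (1 / c₁) / Real.log (1 / r) + 1 ≤ n) :
    1 < n ∧ Real.exp (c₂ * (1 + Real.log n)) * Real.exp (-(Real.log (1 / r) * (n - 1) / 2))
      ≤ 1 / (n : ℝ) ^ 2 ∧ 1 / c₁ ≤ Real.exp (Real.log (1 / r) * (n - 1) / 2) := by
  have hL : 0 < Real.log (1 / r) := Real.log_pos (by rw [lt_div_iff₀ hr0]; linarith)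
  set L := Real.log (1 / r)
  set M := (2 * c₂ + 4) / L + 1 with hMdef
  have hM : 1 < M := by
    have : 0 < (2 * c₂ + 4) / L := by positivity
    linarith
  have hML : (M - 1) * L = 2 * c₂ + 4 := by rw [hMdef]; field_simp; ring
  have hlogM := Real.log_pos hM
  have hn : (1 : ℝ) < n := by
    have : 0 < 5 * M * Real.log M := by positivity
    linarith
  have hn0 : (0 : ℝ) < n := by linarith
  have hA := sub_one_mul_log_le hM (y := n - 1) (by linarith)
  rw [sub_add_cancel] at hA
  have hA' : (2 * c₂ + 4) * Real.log n ≤ L * (n - 1) / 2 := by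
    rw [← hML]; nlinarith
  have hB : M - 1 ≤ M * Real.log M := by
    have h := Real.one_sub_inv_le_log_of_pos (x := M) (by linarith)
    have := mul_le_mul_of_nonneg_left h (by linarith : 0 ≤ M)
    rwa [mul_sub, mul_one, mul_inv_cancel₀ (by linarith)] at this
  have hB' : 5 * (2 * c₂ + 4) ≤ L * (n - 1) := by
    rw [← hML]; nlinarith
  refine ⟨by exact_mod_cast hn, ?_, ?_⟩
  · rw [← Real.exp_add, ← Real.exp_log (show 0 < 1 / (n : ℝ) ^ 2 by positivity),
      Real.log_div one_ne_zero (by positivity), Real.log_pow, Real.log_one]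
    gcongr
    push_cast
    linarith
  · rw [← Real.exp_log (show 0 < 1 / c₁ by positivity)]
    gcongr
    rw [← le_sub_iff_add_le, div_le_iff₀ hL] at h2
    linarith

/-- The error of replacing `∑ A i * β ^ i` by a finite sum weighted with ratios of binomial
coefficients. -/
lemma abs_sum_mul_multichoose_ratio_sub_le {A : ℕ → ℝ} {c₁ c₂ α β s : ℝ} {n : ℕ} (hβ : 0 < β)
    (hβα : β < α) (hc₁ : 0 < c₁) (hc₁' : c₁ < 1) (hc₂ : 0 < c₂) (hn : 1 < n)
    (hA : ∀ i, |A i| ≤ Ring.multichoose c₂ i / α ^ i) (hs : HasSum (fun i => A i * β ^ i) s)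
    (hE : Real.exp (c₂ * (1 + Real.log n)) * Real.exp (-(Real.log (1 / (β / α)) * (n - 1) / 2))
      ≤ 1 / (n : ℝ) ^ 2)
    (hE' : 1 / c₁ ≤ Real.exp (Real.log (1 / (β / α)) * (n - 1) / 2)) :
    |∑ i ∈ Finset.range (n + 1),
        A i * β ^ i * (Ring.multichoose c₁ (n - i) / Ring.multichoose c₁ n) - s|
      ≤ 2 * c₂ * (β / α) / n * (1 / (1 - β / α) ^ (c₂ + 1) + 1) := by
  have hα : 0 < α := hβ.trans hβα
  set r := β / α with hrdef
  have hr0 : 0 < r := by positivity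
  have hr1 : r < 1 := (div_lt_one hα).2 hβα
  have hnR : (1 : ℝ) < n := by exact_mod_cast hn
  have hn0 : (0 : ℝ) < n := by linarith
  set E := Real.exp (-(Real.log (1 / r) * (n - 1) / 2)) with hEdef
  set m := Ring.multichoose c₁ with hm
  have hmpos : ∀ k, 0 < m k := Ring.multichoose_pos hc₁
  have hterm : ∀ i, |A i * β ^ i| ≤ Ring.multichoose c₂ i * r ^ i := fun i => by
    rw [abs_mul, abs_of_pos (pow_pos hβ i), hrdef, div_pow, ← mul_div_assoc, mul_div_right_comm]
    gcongr
    exact hA i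
  set S : ℕ → ℝ := fun i => i * Ring.multichoose c₂ i * r ^ i with hSdef
  have hSnonneg : ∀ i, 0 ≤ S i := fun i => by
    have := (Ring.multichoose_pos hc₂ i).le
    positivity
  have hSsucc : ∀ i, S (i + 1) = c₂ * r * (Ring.multichoose (c₂ + 1) i * r ^ i) := fun i => by
    have h := Ring.succ_mul_multichoose_succ' c₂ i
    simp only [hSdef]
    push_cast
    rw [h]
    ring
  have hSsum : HasSum S (c₂ * r * (1 / (1 - r) ^ (c₂ + 1))) := by
    rw [← hasSum_nat_add_iff' 1]
    simp only [hSsucc, Finset.range_one, Finset.sum_singleton]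
    simpa [hSdef] using (hasSum_multichoose_mul_pow (c₂ + 1)
      (by rwa [abs_of_pos hr0] : |r| < 1)).mul_left (c₂ * r)
  have hrpow : ∀ j : ℕ, r ^ j = Real.exp (-(Real.log (1 / r) * j)) := fun j => by
    rw [one_div, Real.log_inv, neg_mul, neg_neg, mul_comm, Real.exp_nat_mul, Real.exp_log hr0]
  have hLpos : 0 < Real.log (1 / r) := Real.log_pos (by rw [lt_div_iff₀ hr0]; linarith)
  have hSlarge : ∀ i, n < 2 * i → i ≤ n → S i ≤ c₂ * r / (n : ℝ) ^ 2 := by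
    intro i hi hin
    obtain ⟨j, rfl⟩ : ∃ j, i = j + 1 := ⟨i - 1, by omega⟩
    have hj : ((n : ℝ) - 1) / 2 ≤ j := by
      have : (n : ℝ) < 2 * ((j : ℝ) + 1) := by exact_mod_cast hi
      have : (n : ℝ) + 1 ≤ 2 * ((j : ℝ) + 1) := by exact_mod_cast hi
      linarith
    rw [hSsucc, div_eq_mul_one_div]
    gcongr
    refine le_trans (mul_le_mul (Ring.multichoose_add_one_le_exp hc₂ (by omega) hn.le) ?_
      (by positivity) (by positivity)) hE
    rw [hrpow, hEdef, mul_div_assoc]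
    exact Real.exp_le_exp.2 (neg_le_neg (mul_le_mul_of_nonneg_left hj hLpos.le))
  have hSlast : S n / c₁ ≤ c₂ * r / (n : ℝ) ^ 2 := by
    obtain ⟨j, hj⟩ : ∃ j, n = j + 1 := ⟨n - 1, by omega⟩
    have hjR : (j : ℝ) = n - 1 := by rw [hj]; push_cast; ring
    have hEE : r ^ j * (1 / c₁) ≤ E := by
      calc r ^ j * (1 / c₁) ≤ r ^ j * Real.exp (Real.log (1 / r) * (n - 1) / 2) := by gcongr
        _ = E := by rw [hrpow, hjR, ← Real.exp_add, hEdef]; congr 1; ring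
    have h1 : S n / c₁ = c₂ * r * (Ring.multichoose (c₂ + 1) j * (r ^ j * (1 / c₁))) := by
      rw [show S n = S (j + 1) by rw [hj], hSsucc]
      ring
    rw [h1, div_eq_mul_one_div (c₂ * r)]
    gcongr
    exact le_trans (mul_le_mul (Ring.multichoose_add_one_le_exp hc₂ (by omega) hn.le) hEE
      (by positivity) (by positivity)) hE
  have hratio_one : ∀ i, 1 ≤ m (n - i) / m n := fun i => by
    rw [one_le_div (hmpos n)]
    exact Ring.multichoose_antitone hc₁ hc₁'.le (Nat.sub_le n i)
  have hratio : ∀ i < n, m (n - i) / m n - 1 ≤ i / ((n : ℝ) - i) := by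
    intro i hi
    have hi' : (i : ℝ) < n := by exact_mod_cast hi
    have hpos : (0 : ℝ) < n - i := by linarith
    have h := Ring.mul_multichoose_le_mul_multichoose hc₁ (Nat.sub_le n i)
    rw [Nat.cast_sub hi.le] at h
    rw [sub_le_iff_le_add, div_add_one hpos.ne', add_sub_cancel, div_le_div_iff₀ (hmpos n) hpos]
    linarith
  have hratio_n : m 0 / m n ≤ n / c₁ := by
    have h := Ring.mul_multichoose_le_mul_multichoose hc₁ hn.le
    rw [div_le_div_iff₀ (hmpos n) hc₁, hm]
    simpa using h
  set w : ℕ → ℝ := fun i => if i ≤ n then m (n - i) / m n else 0 with hw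
  have hW : HasSum (fun i => A i * β ^ i * w i)
      (∑ i ∈ Finset.range (n + 1), A i * β ^ i * (m (n - i) / m n)) := by
    have h : ∑ i ∈ Finset.range (n + 1), A i * β ^ i * (m (n - i) / m n)
        = ∑ i ∈ Finset.range (n + 1), A i * β ^ i * w i :=
      Finset.sum_congr rfl fun i hi => by
        rw [hw]; simp only; rw [if_pos (by simpa [Nat.lt_succ_iff] using hi)]
    rw [h]
    refine hasSum_sum_of_ne_finset_zero fun i hi => ?_
    rw [hw]; simp only
    rw [if_neg (by simpa [Nat.lt_succ_iff] using hi), mul_zero]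
  set e : ℕ → ℝ := fun i => if i ≤ n then c₂ * r / (n : ℝ) ^ 2 else 0 with he
  have heSum : HasSum e (∑ i ∈ Finset.range (n + 1), e i) :=
    hasSum_sum_of_ne_finset_zero fun i hi => by
      rw [he]; simp only
      rw [if_neg (by simpa [Nat.lt_succ_iff] using hi)]
  have heval : ∑ i ∈ Finset.range (n + 1), e i = (n + 1) * (c₂ * r / (n : ℝ) ^ 2) := by
    rw [Finset.sum_congr rfl fun i hi => if_pos (by simpa [Nat.lt_succ_iff] using hi)]
    simp
  have hbound : ∀ i, |A i * β ^ i * w i - A i * β ^ i| ≤ 2 / n * S i + e i := by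
    intro i
    have hmc := Ring.multichoose_pos hc₂ i
    have hcr : 0 < c₂ * r / (n : ℝ) ^ 2 := by positivity
    have h2S : 0 ≤ 2 / n * S i := mul_nonneg (by positivity) (hSnonneg i)
    rw [← mul_sub_one, abs_mul]
    by_cases hin : i ≤ n
    · rw [hw, he]; simp only
      rw [if_pos hin, if_pos hin, abs_of_nonneg (sub_nonneg.2 (hratio_one i))]
      have hT : |A i * β ^ i| * (m (n - i) / m n - 1)
          ≤ Ring.multichoose c₂ i * r ^ i * (m (n - i) / m n - 1) :=
        mul_le_mul_of_nonneg_right (hterm i) (sub_nonneg.2 (hratio_one i))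
      refine hT.trans ?_
      rcases hin.lt_or_eq with hlt | rfl
      · have hi' : (i : ℝ) + 1 ≤ n := by exact_mod_cast hlt
        have hT2 : Ring.multichoose c₂ i * r ^ i * (m (n - i) / m n - 1)
            ≤ S i * (1 / ((n : ℝ) - i)) := by
          calc _ ≤ Ring.multichoose c₂ i * r ^ i * (i / ((n : ℝ) - i)) := by
                gcongr
                exact hratio i hlt
            _ = _ := by simp only [hSdef]; ring
        refine hT2.trans ?_
        by_cases hhalf : n < 2 * i
        · have h1 : S i * (1 / ((n : ℝ) - i)) ≤ S i * 1 := by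
            have := hSnonneg i
            gcongr
            rw [div_le_one (by linarith)]
            linarith
          linarith [hSlarge i hhalf hin]
        · have hhalf' : 2 * (i : ℝ) ≤ n := by exact_mod_cast not_lt.1 hhalf
          have h1 : S i * (1 / ((n : ℝ) - i)) ≤ S i * (2 / n) := by
            have := hSnonneg i
            gcongr ?_ * ?_
            rw [div_le_div_iff₀ (by linarith) hn0]
            linarith
          linarith
      · rw [Nat.sub_self]
        have h1 : Ring.multichoose c₂ i * r ^ i * (m 0 / m i - 1)
            ≤ Ring.multichoose c₂ i * r ^ i * (i / c₁) := by
          gcongr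
          linarith
        have h2 : Ring.multichoose c₂ i * r ^ i * (i / c₁) = S i / c₁ := by
          simp only [hSdef]; ring
        linarith
    · rw [hw, he]; simp only
      rw [if_neg hin, if_neg hin, zero_sub, abs_neg, abs_one, mul_one, add_zero]
      refine (hterm i).trans ?_
      have hi' : (n : ℝ) ≤ i := by exact_mod_cast (not_le.1 hin).le
      have h1 : 1 ≤ 2 / (n : ℝ) * i := by
        rw [div_mul_eq_mul_div, le_div_iff₀ hn0]; linarith
      calc Ring.multichoose c₂ i * r ^ i = 1 * (Ring.multichoose c₂ i * r ^ i) := (one_mul _).symm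
        _ ≤ 2 / n * i * (Ring.multichoose c₂ i * r ^ i) := by gcongr
        _ = _ := by simp only [hSdef]; ring
  have hfinal := tsum_of_norm_bounded ((hSsum.mul_left (2 / (n : ℝ))).add heSum)
    fun i => (Real.norm_eq_abs _).trans_le (hbound i)
  rw [(hW.sub hs).tsum_eq, heval, Real.norm_eq_abs] at hfinal
  refine hfinal.trans ?_
  have h1 : ((n : ℝ) + 1) * (c₂ * r / (n : ℝ) ^ 2) ≤ 2 * c₂ * r / n := by
    rw [← mul_div_assoc, div_le_div_iff₀ (by positivity) hn0]
    have : 0 < c₂ * r * n := by positivity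
    nlinarith
  calc _ ≤ 2 / (n : ℝ) * (c₂ * r * (1 / (1 - r) ^ (c₂ + 1))) + 2 * c₂ * r / n := by gcongr
    _ = _ := by ring

/-- Effective corollary: with `0 < β < α`, `r = β/α ≤ 1/√2`, `c₁ ∈ (0,1)`, `c₂ > 0`,
`|ãₙ| ≤ c₂/αⁿ`, `a(x) = exp(∑_{n≥1} ãₙxⁿ/n)`, `bₙ = β⁻ⁿ binom(n+c₁−1,n)` and
`fₙ = ∑_{i≤n} aᵢ b_{n−i}`: for every `n` with
`n ≥ max{5((2c₂+4)/ln(1/r) + 1)ln((2c₂+4)/ln(1/r) + 1) + 1, 2 ln(1/c₁)/ln(1/r) + 1}`,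
one has `|fₙ/bₙ − a(β)| ≤ 48 exp(3c₂r) c₂ r / n`. -/
theorem coeff_product_asymptotics_effective
    (α β c₁ c₂ : ℝ) (ta : ℕ → ℝ) (a : ℝ → ℝ)
    (hβ : 0 < β) (hβα : β < α) (hr : β / α ≤ 1 / Real.sqrt 2)
    (hc₁ : c₁ ∈ Set.Ioo (0 : ℝ) 1) (hc₂ : 0 < c₂)
    (hta : ∀ k : ℕ, 1 ≤ k → |ta k| ≤ c₂ / α ^ k)
    (ha : ∀ x : ℝ, a x = Real.exp (∑' k : ℕ, ta (k + 1) * x ^ (k + 1) / ((k : ℝ) + 1))) :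
    ∀ n : ℕ,
      (n : ℝ) ≥
        max (5 * ((2 * c₂ + 4) / Real.log (1 / (β / α)) + 1) *
              Real.log ((2 * c₂ + 4) / Real.log (1 / (β / α)) + 1) + 1)
          (2 * Real.log (1 / c₁) / Real.log (1 / (β / α)) + 1) →
      |(∑ i ∈ Finset.range (n + 1),
            (iteratedDeriv i a 0 / (Nat.factorial i : ℝ)) *
              (β⁻¹ ^ (n - i) * rbinom (((n - i : ℕ) : ℝ) + c₁ - 1) (n - i))) /
          (β⁻¹ ^ n * rbinom ((n : ℝ) + c₁ - 1) n) - a β| ≤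
        48 * Real.exp (3 * c₂ * (β / α)) * c₂ * (β / α) / n := by
  intro n hn
  have hα : 0 < α := hβ.trans hβα
  have hr0 : 0 < β / α := by positivity
  have hr1 : β / α < 1 := (div_lt_one hα).2 hβα
  obtain ⟨h1n, hE, hE'⟩ := two_mul_exp_le hr0 hr1 hc₁.1 hc₂ (le_of_max_le_left hn)
    (le_of_max_le_right hn)
  have hu : ∀ k, |ta (k + 1)| ≤ c₂ / α ^ (k + 1) := fun k => hta (k + 1) (by omega)
  have hsum : ∀ x, |x| < α →
      HasSum (fun i => expSeriesCoeff (fun k => ta (k + 1)) i * x ^ i) (a x) := fun x hx => by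
    rw [ha]
    exact hasSum_expSeriesCoeff_mul_pow hα hu hx
  have hmain := abs_sum_mul_multichoose_ratio_sub_le hβ hβα hc₁.1 hc₁.2 hc₂ h1n
    (abs_expSeriesCoeff_le hu) (hsum β (by rwa [abs_of_pos hβ])) hE hE'
  have heq : (∑ i ∈ Finset.range (n + 1),
            (iteratedDeriv i a 0 / (Nat.factorial i : ℝ)) *
              (β⁻¹ ^ (n - i) * rbinom (((n - i : ℕ) : ℝ) + c₁ - 1) (n - i))) /
          (β⁻¹ ^ n * rbinom ((n : ℝ) + c₁ - 1) n)
      = ∑ i ∈ Finset.range (n + 1), expSeriesCoeff (fun k => ta (k + 1)) i * β ^ i *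
          (Ring.multichoose c₁ (n - i) / Ring.multichoose c₁ n) := by
    rw [Finset.sum_div]
    refine Finset.sum_congr rfl fun i hi => ?_
    have hi := Finset.mem_range.1 hi
    rw [iteratedDeriv_div_factorial_eq_of_hasSum hα hsum, rbinom_eq_multichoose,
      rbinom_eq_multichoose]
    have hm := (Ring.multichoose_pos hc₁.1 n).ne'
    have hpow : β⁻¹ ^ (n - i) = β⁻¹ ^ n * β ^ i := by
      rw [pow_sub₀ _ (by positivity) (by omega), inv_pow β i, inv_inv]
    have hβn : β⁻¹ ^ n ≠ 0 := by positivity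
    rw [hpow]
    field_simp
  rw [heq]
  refine hmain.trans ?_
  set r := β / α
  have hn0 : (0 : ℝ) < n := by exact_mod_cast (by omega : 0 < n)
  have hbase := exp_neg_three_mul_le_one_sub hr0.le hr
  have hr2 : r ≤ 3 / 4 := by
    refine hr.trans ?_
    rw [div_le_iff₀ (by positivity)]
    nlinarith [Real.sq_sqrt (show (0 : ℝ) ≤ 2 by norm_num), Real.sqrt_nonneg 2]
  have hpow : 1 / (1 - r) ^ (c₂ + 1) ≤ 4 * Real.exp (3 * c₂ * r) := by
    rw [Real.rpow_add (by linarith), Real.rpow_one, div_le_iff₀ (by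
      have : 0 < 1 - r := by linarith
      positivity)]
    have h1 : Real.exp (-(3 * r)) ^ c₂ ≤ (1 - r) ^ c₂ := by gcongr
    rw [← Real.exp_mul] at h1
    calc (1 : ℝ) ≤ 4 * (1 - r) * 1 := by linarith
      _ = 4 * (1 - r) * (Real.exp (3 * c₂ * r) * Real.exp (-(3 * r) * c₂)) := by
          rw [← Real.exp_add, show 3 * c₂ * r + -(3 * r) * c₂ = 0 by ring, Real.exp_zero]
      _ ≤ 4 * (1 - r) * (Real.exp (3 * c₂ * r) * (1 - r) ^ c₂) := by
          have : 0 < 1 - r := by linarith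
          gcongr
      _ = _ := by ring
  have hexp : 1 ≤ Real.exp (3 * c₂ * r) := Real.one_le_exp (by positivity)
  calc 2 * c₂ * r / n * (1 / (1 - r) ^ (c₂ + 1) + 1)
      ≤ 2 * c₂ * r / n * (24 * Real.exp (3 * c₂ * r)) := by
        gcongr
        linarith
    _ = _ := by ring
end

section
/- For every real number c₁ that is not an integer and all integers n ≥ i ≥ 0, the identity (−1)^i · binom(−c₁, n−i) / binom(−c₁, n) = ∑_{k=0}^{i} binom(i,k) · binom(k−c₁, k) / binom(n+c₁−1, k) holds. -/
/-- The falling factorial product satisfies `(x)ₖ₊₁ = x (x - 1)ₖ`. -/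
lemma prod_sub_range_succ' (x : ℝ) (k : ℕ) :
    ∏ j ∈ Finset.range (k + 1), (x - (j : ℝ)) = x * ∏ j ∈ Finset.range k, (x - 1 - (j : ℝ)) := by
  rw [Finset.prod_range_succ', mul_comm]
  congr 1
  · simp
  · refine Finset.prod_congr rfl fun j _ => ?_
    push_cast
    ring

/-- The rising factorial product satisfies `a⁽ᵏ⁺¹⁾ = a (a + 1)⁽ᵏ⁾`. -/
lemma prod_add_range_succ' (a : ℝ) (k : ℕ) :
    ∏ j ∈ Finset.range (k + 1), (a + (j : ℝ)) = a * ∏ j ∈ Finset.range k, (a + 1 + (j : ℝ)) := by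
  rw [Finset.prod_range_succ', mul_comm]
  congr 1
  · simp
  · refine Finset.prod_congr rfl fun j _ => ?_
    push_cast
    ring

/-- A Chu-Vandermonde identity: the binomial transform of rising over falling factorials. -/
lemma sum_choose_mul_rising_div_falling (i : ℕ) (x a : ℝ) (hx : ∀ j : ℕ, x - (j : ℝ) ≠ 0) :
    ∑ k ∈ Finset.range (i + 1), (Nat.choose i k : ℝ) *
        ((∏ j ∈ Finset.range k, (a + (j : ℝ))) / ∏ j ∈ Finset.range k, (x - (j : ℝ))) =
      (∏ j ∈ Finset.range i, (x + a - (j : ℝ))) / ∏ j ∈ Finset.range i, (x - (j : ℝ)) := by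
  induction i generalizing x a with
  | zero => simp
  | succ i ih =>
    have hx1 : ∀ j : ℕ, x - 1 - (j : ℝ) ≠ 0 := fun j => by
      have := hx (j + 1)
      push_cast at this
      rwa [sub_sub, add_comm 1 (j : ℝ)]
    have hx0 : x ≠ 0 := by simpa using hx 0
    have hF : ∏ j ∈ Finset.range i, (x - (j : ℝ)) ≠ 0 := Finset.prod_ne_zero_iff.2 fun j _ => hx j
    have hF1 : ∏ j ∈ Finset.range i, (x - 1 - (j : ℝ)) ≠ 0 :=
      Finset.prod_ne_zero_iff.2 fun j _ => hx1 j
    have hrec : (∏ j ∈ Finset.range i, (x - (j : ℝ))) * (x - i) =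
        x * ∏ j ∈ Finset.range i, (x - 1 - (j : ℝ)) := by
      rw [← prod_sub_range_succ', Finset.prod_range_succ]
    have hshift := ih (x - 1) (a + 1) hx1
    rw [show x - 1 + (a + 1) = x + a by ring] at hshift
    set f : ℕ → ℝ := fun k =>
      (∏ j ∈ Finset.range k, (a + (j : ℝ))) / ∏ j ∈ Finset.range k, (x - (j : ℝ)) with hf
    have hpascal : ∑ k ∈ Finset.range (i + 2), (Nat.choose (i + 1) k : ℝ) * f k =
        ∑ k ∈ Finset.range (i + 1), (Nat.choose i k : ℝ) * f k +
          ∑ k ∈ Finset.range (i + 1), (Nat.choose i k : ℝ) * f (k + 1) := by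
      have hext : ∑ k ∈ Finset.range (i + 1), (Nat.choose i k : ℝ) * f k =
          ∑ k ∈ Finset.range (i + 2), (Nat.choose i k : ℝ) * f k := by
        rw [Finset.sum_range_succ _ (i + 1)]
        simp
      rw [hext, Finset.sum_range_succ', Finset.sum_range_succ' _ (i + 1)]
      simp only [Nat.choose_succ_succ, Nat.cast_add, add_mul, Finset.sum_add_distrib]
      simp
      ring
    have hsucc : ∑ k ∈ Finset.range (i + 1), (Nat.choose i k : ℝ) * f (k + 1) =
        a / x * ((∏ j ∈ Finset.range i, (x + a - (j : ℝ))) /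
          ∏ j ∈ Finset.range i, (x - 1 - (j : ℝ))) := by
      rw [← hshift, Finset.mul_sum]
      refine Finset.sum_congr rfl fun k _ => ?_
      simp only [hf, prod_sub_range_succ', prod_add_range_succ', mul_div_mul_comm]
      ring
    rw [hpascal, hsucc, ih x a hx, Finset.prod_range_succ, Finset.prod_range_succ, hrec]
    field_simp
    linear_combination (∏ j ∈ Finset.range i, (x + a - (j : ℝ))) * (-hrec)

/-- Splitting the top `i` factors off a falling factorial of `-c`. -/
lemma prod_neg_sub_range_add (c : ℝ) (m i : ℕ) :
    ∏ j ∈ Finset.range (m + i), (-c - (j : ℝ)) =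
      (-1) ^ i * (∏ j ∈ Finset.range m, (-c - (j : ℝ))) *
        ∏ j ∈ Finset.range i, (((m + i : ℕ) : ℝ) + c - 1 - (j : ℝ)) := by
  induction i with
  | zero => simp
  | succ i ih =>
    rw [← add_assoc, Finset.prod_range_succ, ih, prod_sub_range_succ']
    push_cast
    rw [show (m : ℝ) + i + 1 + c - 1 - 1 = m + i + c - 1 by ring]
    ring

lemma factorial_add_eq_mul_prod (m i : ℕ) :
    ((m + i).factorial : ℝ) =
      m.factorial * ∏ j ∈ Finset.range i, (((m + i : ℕ) : ℝ) - (j : ℝ)) := by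
  induction i with
  | zero => simp
  | succ i ih =>
    rw [← add_assoc, Nat.factorial_succ, Nat.cast_mul, ih, prod_sub_range_succ']
    push_cast
    rw [show (m : ℝ) + i + 1 - 1 = m + i by ring]
    ring

lemma rbinom_natCast_sub (c : ℝ) (k : ℕ) :
    rbinom ((k : ℝ) - c) k =
      (∏ j ∈ Finset.range k, (1 - c + (j : ℝ))) / (k.factorial : ℝ) := by
  rw [rbinom, ← Finset.prod_range_reflect]
  congr 1
  refine Finset.prod_congr rfl fun j hj => ?_
  have hj' := Finset.mem_range.1 hj
  rw [Nat.sub_sub, Nat.cast_sub (by omega)]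
  push_cast
  ring

/-- For every non-integer real `c₁` and integers `n ≥ i ≥ 0`:
`(−1)ⁱ binom(−c₁, n−i)/binom(−c₁, n) = ∑_{k=0}^{i} binom(i,k) binom(k−c₁,k)/binom(n+c₁−1,k)`. -/
theorem binom_difference_identity
    (c₁ : ℝ) (hc₁ : ∀ z : ℤ, c₁ ≠ (z : ℝ)) (n i : ℕ) (hin : i ≤ n) :
    (-1 : ℝ) ^ i * rbinom (-c₁) (n - i) / rbinom (-c₁) n =
      ∑ k ∈ Finset.range (i + 1),
        (Nat.choose i k : ℝ) * rbinom ((k : ℝ) - c₁) k / rbinom ((n : ℝ) + c₁ - 1) k := by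
  obtain ⟨m, rfl⟩ := Nat.exists_eq_add_of_le' hin
  have hx : ∀ j : ℕ, ((m + i : ℕ) : ℝ) + c₁ - 1 - (j : ℝ) ≠ 0 := fun j h =>
    hc₁ (1 + j - (m + i : ℕ)) (by push_cast at h ⊢; linarith)
  have hc : ∀ j : ℕ, -c₁ - (j : ℝ) ≠ 0 := fun j h =>
    hc₁ (-j) (by push_cast; linarith)
  have hsum := sum_choose_mul_rising_div_falling i _ (1 - c₁) hx
  rw [show ((m + i : ℕ) : ℝ) + c₁ - 1 + (1 - c₁) = ((m + i : ℕ) : ℝ) by ring] at hsum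
  have hterm : ∀ k : ℕ, (Nat.choose i k : ℝ) * rbinom ((k : ℝ) - c₁) k /
      rbinom (((m + i : ℕ) : ℝ) + c₁ - 1) k = (Nat.choose i k : ℝ) *
        ((∏ j ∈ Finset.range k, (1 - c₁ + (j : ℝ))) /
          ∏ j ∈ Finset.range k, (((m + i : ℕ) : ℝ) + c₁ - 1 - (j : ℝ))) := fun k => by
    rw [rbinom_natCast_sub, rbinom, mul_div_assoc,
      div_div_div_cancel_right₀ (Nat.cast_ne_zero.2 k.factorial_ne_zero)]
  rw [Finset.sum_congr rfl fun k _ => hterm k, hsum, Nat.add_sub_cancel, rbinom, rbinom,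
    prod_neg_sub_range_add, factorial_add_eq_mul_prod]
  have hF : ∏ j ∈ Finset.range i, (((m + i : ℕ) : ℝ) + c₁ - 1 - (j : ℝ)) ≠ 0 :=
    Finset.prod_ne_zero_iff.2 fun j _ => hx j
  have hG : ∏ j ∈ Finset.range m, (-c₁ - (j : ℝ)) ≠ 0 :=
    Finset.prod_ne_zero_iff.2 fun j _ => hc j
  have hm : (m.factorial : ℝ) ≠ 0 := Nat.cast_ne_zero.2 m.factorial_ne_zero
  have hs : (-1 : ℝ) ^ i ≠ 0 := by simp
  field_simp
end

section
/- For every c₁ ∈ (0,1) and all integers m, i, n with m < i ≤ n: if i < n then ∑_{k=m+1}^{i} binom(i,k)·binom(k−c₁,k)/binom(n+c₁−1,k) ≤ ((i)_{m+1}/(n+c₁−1)_{m+1})·(i−m), and if i = n then ∑_{k=m+1}^{n} binom(n,k)·binom(k−c₁,k)/binom(n+c₁−1,k) ≤ n·(ln(n−m) + 2/c₁). -/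
theorem ffall_succ (x : ℝ) (k : ℕ) : ffall x (k + 1) = ffall x k * (x - k) :=
  Finset.prod_range_succ _ _

theorem ffall_natCast (i k : ℕ) : ffall (i : ℝ) k = (i.descFactorial k : ℝ) := by
  induction k with
  | zero => simp [ffall]
  | succ k ih =>
    rw [ffall_succ, ih, Nat.descFactorial_succ, Nat.cast_mul]
    rcases le_or_gt k i with h | h
    · rw [Nat.cast_sub h, mul_comm]
    · simp [Nat.descFactorial_of_lt h]

theorem ffall_pos {x : ℝ} {k : ℕ} (h : (k : ℝ) < x + 1) : 0 < ffall x k := by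
  refine Finset.prod_pos fun j hj => ?_
  have : (j : ℝ) + 1 ≤ k := by exact_mod_cast Finset.mem_range.1 hj
  linarith

theorem ffall_natCast_nonneg (i k : ℕ) : 0 ≤ ffall (i : ℝ) k := by
  rw [ffall_natCast]
  positivity

theorem choose_mul_div_rbinom (i k : ℕ) (x y : ℝ) :
    (Nat.choose i k : ℝ) * y / rbinom x k = ffall (i : ℝ) k / ffall x k * y := by
  have hx : rbinom x k = ffall x k / (Nat.factorial k : ℝ) := rfl
  rw [hx, ffall_natCast, Nat.descFactorial_eq_factorial_mul_choose, div_div_eq_mul_div]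
  push_cast
  ring

theorem rbinom_natCast_sub_le_one {c : ℝ} (hc : c ∈ Set.Ioo (0 : ℝ) 1) (k : ℕ) :
    rbinom ((k : ℝ) - c) k ≤ 1 := by
  have hk : (∏ j ∈ Finset.range k, ((k : ℝ) - j)) = (Nat.factorial k : ℝ) := by
    rw [← Nat.descFactorial_self, ← ffall_natCast, ffall]
  rw [rbinom, div_le_one (by positivity), ← hk]
  refine Finset.prod_le_prod (fun j hj => ?_) fun j _ => ?_
  · have : (j : ℝ) + 1 ≤ k := by exact_mod_cast Finset.mem_range.1 hj
    linarith [hc.2]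
  · linarith [hc.1]

/-- Each summand is at most the corresponding ratio of falling factorials. -/
theorem choose_mul_rbinom_div_rbinom_le {c : ℝ} (hc : c ∈ Set.Ioo (0 : ℝ) 1) {k n : ℕ} (i : ℕ)
    (hkn : k ≤ n) :
    (Nat.choose i k : ℝ) * rbinom ((k : ℝ) - c) k / rbinom ((n : ℝ) + c - 1) k ≤
      ffall (i : ℝ) k / ffall ((n : ℝ) + c - 1) k := by
  have hkn' : (k : ℝ) ≤ n := by exact_mod_cast hkn
  rw [choose_mul_div_rbinom]
  refine mul_le_of_le_one_right (div_nonneg (ffall_natCast_nonneg i k) (ffall_pos ?_).le)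
    (rbinom_natCast_sub_le_one hc k)
  linarith [hc.1]

theorem ffall_div_ffall_le_of_le {x : ℝ} {i k l : ℕ} (hix : (i : ℝ) ≤ x) (hkl : k ≤ l)
    (hli : l ≤ i) : ffall (i : ℝ) l / ffall x l ≤ ffall (i : ℝ) k / ffall x k := by
  induction l, hkl using Nat.le_induction with
  | base => exact le_rfl
  | succ l hkl ih =>
    have hl : (l : ℝ) + 1 ≤ i := by exact_mod_cast hli
    refine le_trans ?_ (ih (by omega))
    rw [ffall_succ, ffall_succ, mul_div_mul_comm]
    refine mul_le_of_le_one_right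
      (div_nonneg (ffall_natCast_nonneg i l) (ffall_pos (by linarith)).le) ?_
    exact (div_le_one (by linarith)).2 (by linarith)

theorem ffall_natCast_succ_le {c : ℝ} (hc : 0 < c) {n k : ℕ} (hk : k < n) :
    ffall (n : ℝ) (k + 1) ≤ n * ffall ((n : ℝ) + c - 1) k := by
  induction k with
  | zero => simp [ffall]
  | succ k ih =>
    have hk' : (k : ℝ) + 1 + 1 ≤ n := by exact_mod_cast hk
    rw [ffall_succ, ffall_succ (_ - 1) k, ← mul_assoc]
    push_cast
    exact mul_le_mul (ih (by omega)) (by linarith) (by linarith)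
      (mul_nonneg n.cast_nonneg (ffall_pos (by linarith)).le)

theorem ffall_div_ffall_le {c : ℝ} (hc : 0 < c) {n k : ℕ} (hk : 0 < k) (hkn : k ≤ n) :
    ffall (n : ℝ) k / ffall ((n : ℝ) + c - 1) k ≤ n * ((n : ℝ) - k + c)⁻¹ := by
  obtain ⟨k, rfl⟩ := Nat.exists_eq_add_of_lt hk
  rw [zero_add] at *
  have hk' : (k : ℝ) + 1 ≤ n := by exact_mod_cast hkn
  have hpos : 0 < ffall ((n : ℝ) + c - 1) k := ffall_pos (by linarith)
  have hd : (n : ℝ) + c - 1 - k = n - ((k + 1 : ℕ) : ℝ) + c := by push_cast; ring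
  have hd0 : 0 < (n : ℝ) - ((k + 1 : ℕ) : ℝ) + c := by push_cast; linarith
  rw [ffall_succ (_ - 1) k, hd, ← div_div, ← div_eq_mul_inv]
  gcongr
  rw [div_le_iff₀ hpos]
  exact ffall_natCast_succ_le hc hkn

theorem sum_inv_sub_add_le {c : ℝ} (hc : c ∈ Set.Ioo (0 : ℝ) 1) {m n : ℕ} (hmn : m < n) :
    ∑ k ∈ Finset.Icc (m + 1) n, ((n : ℝ) - k + c)⁻¹ ≤ Real.log ((n : ℝ) - m) + 2 / c := by
  obtain ⟨N, rfl⟩ := Nat.exists_eq_add_of_lt hmn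
  have hreindex : ∑ k ∈ Finset.Icc (m + 1) (m + N + 1), (((m + N + 1 : ℕ) : ℝ) - k + c)⁻¹ =
      ∑ j ∈ Finset.range (N + 1), ((j : ℝ) + c)⁻¹ := by
    refine Finset.sum_nbij' (fun k => m + N + 1 - k) (fun j => m + N + 1 - j) ?_ ?_ ?_ ?_ ?_
    · intro k hk; simp only [Finset.mem_Icc, Finset.mem_range] at *; omega
    · intro k hk; simp only [Finset.mem_Icc, Finset.mem_range] at *; omega
    · intro k hk; simp only [Finset.mem_Icc] at *; omega
    · intro k hk; simp only [Finset.mem_range] at *; omega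
    · intro k hk
      rw [Nat.cast_sub (Finset.mem_Icc.1 hk).2]
  have hharm : ∑ j ∈ Finset.range N, (((j + 1 : ℕ) : ℝ) + c)⁻¹ ≤ (harmonic N : ℝ) := by
    rw [harmonic]
    push_cast
    refine Finset.sum_le_sum fun j _ => ?_
    exact inv_anti₀ (by positivity) (by linarith [hc.1])
  have hlog : Real.log (N : ℝ) ≤ Real.log ((N : ℝ) + 1) := by
    rcases N.eq_zero_or_pos with rfl | hN
    · simp
    · exact Real.log_le_log (by exact_mod_cast hN) (by linarith)
  have hc1 : 1 ≤ c⁻¹ := (one_le_inv₀ hc.1).2 hc.2.le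
  have hcast : (((m + N + 1 : ℕ) : ℝ) - m) = N + 1 := by push_cast; ring
  rw [hreindex, Finset.sum_range_succ', hcast, Nat.cast_zero, zero_add, div_eq_mul_inv]
  linarith [harmonic_le_one_add_log N]

/-- For `c₁ ∈ (0,1)` and integers `m < i ≤ n`:
if `i < n` then `∑_{k=m+1}^{i} binom(i,k)binom(k−c₁,k)/binom(n+c₁−1,k)
 ≤ ((i)_{m+1}/(n+c₁−1)_{m+1})(i−m)`, and if `i = n` then
`∑_{k=m+1}^{n} binom(n,k)binom(k−c₁,k)/binom(n+c₁−1,k) ≤ n(ln(n−m) + 2/c₁)`. -/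
theorem binom_tail_sum_bound
    (c₁ : ℝ) (hc₁ : c₁ ∈ Set.Ioo (0 : ℝ) 1) (m i n : ℕ) (hmi : m < i) (hin : i ≤ n) :
    (i < n →
      ∑ k ∈ Finset.Icc (m + 1) i,
          (Nat.choose i k : ℝ) * rbinom ((k : ℝ) - c₁) k / rbinom ((n : ℝ) + c₁ - 1) k ≤
        (ffall (i : ℝ) (m + 1) / ffall ((n : ℝ) + c₁ - 1) (m + 1)) * ((i : ℝ) - (m : ℝ))) ∧
    (i = n →
      ∑ k ∈ Finset.Icc (m + 1) n,
          (Nat.choose n k : ℝ) * rbinom ((k : ℝ) - c₁) k / rbinom ((n : ℝ) + c₁ - 1) k ≤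
        (n : ℝ) * (Real.log ((n : ℝ) - (m : ℝ)) + 2 / c₁)) := by
  constructor
  · intro hlt
    have hix : (i : ℝ) ≤ (n : ℝ) + c₁ - 1 := by
      have : (i : ℝ) + 1 ≤ n := by exact_mod_cast hlt
      linarith [hc₁.1]
    refine (Finset.sum_le_card_nsmul _ _
      (ffall (i : ℝ) (m + 1) / ffall ((n : ℝ) + c₁ - 1) (m + 1)) fun k hk => ?_).trans_eq ?_
    · obtain ⟨hmk, hki⟩ := Finset.mem_Icc.1 hk
      exact (choose_mul_rbinom_div_rbinom_le hc₁ i (hki.trans hin)).trans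
        (ffall_div_ffall_le_of_le hix hmk hki)
    · rw [Nat.card_Icc, nsmul_eq_mul, Nat.add_sub_add_right, Nat.cast_sub hmi.le, mul_comm]
  · rintro rfl
    refine (Finset.sum_le_sum fun k hk => ?_).trans
      ((Finset.mul_sum _ _ _).symm.trans_le
        (mul_le_mul_of_nonneg_left (sum_inv_sub_add_le hc₁ hmi) i.cast_nonneg))
    obtain ⟨hmk, hki⟩ := Finset.mem_Icc.1 hk
    exact (choose_mul_rbinom_div_rbinom_le hc₁ i hki).trans
      (ffall_div_ffall_le hc₁.1 (by omega) hki)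
end

section
/- Let α, c₂ > 0, let (ãₙ)_{n≥1} be a real sequence with |ãₙ| ≤ c₂/αⁿ for all n ≥ 1, and let a(x) = exp(∑_{n≥1} ãₙ xⁿ/n), a power series with radius of convergence at least α. Then for every integer i ≥ 0 and every real x with 0 ≤ x < α, the i-th derivative satisfies |a^{(i)}(x)| ≤ α^{−i} · (c₂+i−1)_i · (1−x/α)^{−c₂−i}. -/
open Finset Set

/-- Coefficients of the `j`-th derivative of the power series `∑ k, t k * x ^ k`. -/
def derivCoeff (t : ℕ → ℝ) (j k : ℕ) : ℝ := ((k + j).descFactorial j : ℝ) * t (k + j)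

/-- The power series obtained from `∑ k, t k * x ^ k` by differentiating `j` times termwise. -/
noncomputable def derivSeries (t : ℕ → ℝ) (j : ℕ) (x : ℝ) : ℝ := ∑' k, derivCoeff t j k * x ^ k

lemma derivCoeff_zero (t : ℕ → ℝ) (k : ℕ) : derivCoeff t 0 k = t k := by simp [derivCoeff]

lemma derivCoeff_succ (t : ℕ → ℝ) (j k : ℕ) :
    derivCoeff t (j + 1) k = (k + 1) * derivCoeff t j (k + 1) := by
  have h := Nat.succ_descFactorial (k + j) j
  rw [show k + j + 1 - j = k + 1 by omega, ← Nat.succ_descFactorial_succ] at h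
  have h' : ((k + 1 : ℕ) : ℝ) * ((k + j + 1).descFactorial j : ℝ)
      = ((k + j + 1).descFactorial (j + 1) : ℝ) := by exact_mod_cast h
  simp only [derivCoeff]
  rw [← add_assoc, show k + 1 + j = k + j + 1 by omega, ← h']
  push_cast
  ring

/-- A power series may be differentiated termwise inside its disc of convergence. -/
lemma hasDerivAt_tsum_pow_succ_div {α : ℝ} {h : ℕ → ℝ}
    (hs : ∀ x, |x| < α → Summable fun k => |h k * x ^ k|) {x : ℝ} (hx : |x| < α) :
    HasDerivAt (fun y => ∑' k : ℕ, h k * y ^ (k + 1) / ((k : ℝ) + 1)) (∑' k, h k * x ^ k) x := by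
  obtain ⟨r, hxr, hrα⟩ := exists_between hx
  have hr : 0 < r := (abs_nonneg x).trans_lt hxr
  refine hasDerivAt_tsum_of_isPreconnected (𝕜 := ℝ) (F := ℝ)
    (g := fun k y => h k * y ^ (k + 1) / ((k : ℝ) + 1)) (g' := fun k y => h k * y ^ k)
    (u := fun k => |h k * r ^ k|) (t := Ioo (-r) r) (y₀ := 0)
    (hs r (by rwa [abs_of_pos hr])) isOpen_Ioo isPreconnected_Ioo ?_ ?_ ⟨by linarith, hr⟩ ?_
    (abs_lt.1 hxr)
  · intro k y _
    have hk : (k : ℝ) + 1 ≠ 0 := by positivity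
    refine (((hasDerivAt_pow (k + 1) y).const_mul (h k)).div_const ((k : ℝ) + 1)).congr_deriv ?_
    push_cast
    field_simp
  · intro k y hy
    rw [Real.norm_eq_abs, abs_mul, abs_mul, abs_pow, abs_pow, abs_of_pos hr]
    gcongr
    exact (abs_lt.2 hy).le
  · simp

section GeometricBound

variable {α c : ℝ} {t : ℕ → ℝ}

lemma abs_derivCoeff_mul_pow_le (hα : 0 < α) (ht : ∀ k, |t k| ≤ c / α ^ (k + 1)) (j k : ℕ)
    (x : ℝ) :
    |derivCoeff t j k * x ^ k| ≤
      c * (j.factorial : ℝ) / α ^ (j + 1) * (((k + j).choose j : ℝ) * (|x| / α) ^ k) := by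
  have h1 : |derivCoeff t j k * x ^ k|
      = ((j.factorial : ℝ) * ((k + j).choose j : ℝ)) * |t (k + j)| * |x| ^ k := by
    rw [abs_mul, derivCoeff, abs_mul, Nat.abs_cast, abs_pow,
      Nat.descFactorial_eq_factorial_mul_choose, Nat.cast_mul]
  rw [h1]
  calc _ ≤ ((j.factorial : ℝ) * ((k + j).choose j : ℝ)) * (c / α ^ (k + j + 1)) * |x| ^ k := by
        gcongr
        exact ht _
    _ = _ := by
        rw [div_pow]
        field_simp
        ring

lemma hasSum_choose_mul_abs_div_pow (hα : 0 < α) (j : ℕ) {x : ℝ} (hx : |x| < α) :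
    HasSum (fun k => c * (j.factorial : ℝ) / α ^ (j + 1) *
        (((k + j).choose j : ℝ) * (|x| / α) ^ k))
      (c * (j.factorial : ℝ) / α ^ (j + 1) * (1 / (1 - |x| / α) ^ (j + 1))) := by
  have hr : ‖|x| / α‖ < 1 := by
    rw [Real.norm_eq_abs, abs_of_nonneg (by positivity)]
    exact (div_lt_one hα).2 hx
  exact (hasSum_choose_mul_geometric_of_norm_lt_one j hr).mul_left _

lemma summable_abs_derivCoeff (hα : 0 < α) (ht : ∀ k, |t k| ≤ c / α ^ (k + 1)) (j : ℕ) {x : ℝ}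
    (hx : |x| < α) : Summable fun k => |derivCoeff t j k * x ^ k| :=
  Summable.of_nonneg_of_le (fun _ => abs_nonneg _)
    (fun k => abs_derivCoeff_mul_pow_le hα ht j k x) (hasSum_choose_mul_abs_div_pow hα j hx).summable

lemma abs_derivSeries_le (hα : 0 < α) (ht : ∀ k, |t k| ≤ c / α ^ (k + 1)) (j : ℕ) {x : ℝ}
    (hx : |x| < α) :
    |derivSeries t j x| ≤
      c * (j.factorial : ℝ) / α ^ (j + 1) * (1 / (1 - |x| / α) ^ (j + 1)) := by
  rw [← Real.norm_eq_abs]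
  exact tsum_of_norm_bounded (hasSum_choose_mul_abs_div_pow hα j hx) fun k => abs_derivCoeff_mul_pow_le hα ht j k x

lemma hasDerivAt_derivSeries (hα : 0 < α) (ht : ∀ k, |t k| ≤ c / α ^ (k + 1)) (j : ℕ) {x : ℝ}
    (hx : |x| < α) : HasDerivAt (derivSeries t j) (derivSeries t (j + 1) x) x := by
  have h := (hasDerivAt_tsum_pow_succ_div
    (fun y hy => summable_abs_derivCoeff hα ht (j + 1) hy) hx).const_add (derivCoeff t j 0)
  refine h.congr_of_eventuallyEq ?_
  filter_upwards [continuous_abs.continuousAt.eventually_lt continuousAt_const hx] with y hy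
  rw [derivSeries, (summable_abs_derivCoeff hα ht j hy).of_abs.tsum_eq_zero_add]
  simp only [pow_zero, mul_one]
  congr 1
  refine tsum_congr fun k => ?_
  have hk : (k : ℝ) + 1 ≠ 0 := by positivity
  rw [derivCoeff_succ]
  field_simp

end GeometricBound

lemma contDiffOn_of_hasDerivAt_succ {s : Set ℝ} (hs : IsOpen s) {f : ℕ → ℝ → ℝ}
    (hf : ∀ j, ∀ x ∈ s, HasDerivAt (f j) (f (j + 1) x) x) (n j : ℕ) : ContDiffOn ℝ n (f j) s := by
  induction n generalizing j with
  | zero =>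
    exact contDiffOn_zero.2 fun x hx => (hf j x hx).continuousAt.continuousWithinAt
  | succ n ih =>
    push_cast
    refine (contDiffOn_succ_iff_deriv_of_isOpen hs).2
      ⟨fun x hx => (hf j x hx).differentiableAt.differentiableWithinAt, by simp, ?_⟩
    exact (ih (j + 1)).congr fun x hx => (hf j x hx).deriv

lemma iteratedDeriv_of_hasDerivAt_succ {s : Set ℝ} (hs : IsOpen s) {f : ℕ → ℝ → ℝ}
    (hf : ∀ j, ∀ x ∈ s, HasDerivAt (f j) (f (j + 1) x) x) (n j : ℕ) {x : ℝ} (hx : x ∈ s) :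
    iteratedDeriv n (f j) x = f (j + n) x := by
  induction n generalizing j with
  | zero => simp
  | succ n ih =>
    rw [iteratedDeriv_succ', Set.EqOn.iteratedDeriv_of_isOpen
      (fun y hy => (hf j y hy).deriv) hs n hx, ih (j + 1)]
    congr 1
    omega

/-- The rising factorial `c (c + 1) ⋯ (c + i - 1)`, written as a falling factorial, satisfies the
usual recursion. -/
lemma ffall_rising_succ (c : ℝ) (i : ℕ) :
    ffall (c + ((i + 1 : ℕ) : ℝ) - 1) (i + 1) = (c + i) * ffall (c + (i : ℝ) - 1) i := by
  rw [ffall, prod_range_succ', mul_comm, ffall]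
  push_cast
  congr 1
  · ring
  · exact prod_congr rfl fun k _ => by ring

lemma ffall_rising_nonneg {c : ℝ} (hc : 0 ≤ c) (i : ℕ) : 0 ≤ ffall (c + (i : ℝ) - 1) i := by
  induction i with
  | zero => simp [ffall]
  | succ i ih => rw [ffall_rising_succ]; positivity

lemma sum_descFactorial_mul_ffall_rising (c : ℝ) (i : ℕ) :
    ∑ j ∈ range (i + 1), (i.descFactorial j : ℝ) * c *
        ffall (c + ((i - j : ℕ) : ℝ) - 1) (i - j) =
      ffall (c + ((i + 1 : ℕ) : ℝ) - 1) (i + 1) := by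
  induction i with
  | zero => simp [ffall]
  | succ i ih =>
    rw [sum_range_succ', ffall_rising_succ, add_mul (c : ℝ), add_comm]
    congr 1
    · simp
    · rw [← ih, mul_sum]
      refine sum_congr rfl fun j _ => ?_
      rw [Nat.succ_descFactorial_succ, Nat.add_sub_add_right]
      push_cast
      ring

/-- Derivative bounds: if `|ãₙ| ≤ c₂/αⁿ` for `n ≥ 1` and
`a(x) = exp(∑_{n≥1} ãₙ xⁿ/n)`, then for every `i ≥ 0` and `0 ≤ x < α`,
`|a⁽ⁱ⁾(x)| ≤ α⁻ⁱ (c₂+i−1)_i (1−x/α)^{−c₂−i}`. -/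
theorem iterated_deriv_bound
    (α c₂ : ℝ) (hα : 0 < α) (hc₂ : 0 < c₂) (ta : ℕ → ℝ) (a : ℝ → ℝ)
    (hta : ∀ k : ℕ, 1 ≤ k → |ta k| ≤ c₂ / α ^ k)
    (ha : ∀ x : ℝ, a x = Real.exp (∑' k : ℕ, ta (k + 1) * x ^ (k + 1) / ((k : ℝ) + 1))) :
    ∀ (i : ℕ) (x : ℝ), 0 ≤ x → x < α →
      |iteratedDeriv i a x| ≤
        (α ^ i)⁻¹ * ffall (c₂ + (i : ℝ) - 1) i * (1 - x / α) ^ (-c₂ - (i : ℝ)) := by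
  intro i x hx0 hxα
  set t : ℕ → ℝ := fun k => ta (k + 1)
  have ht : ∀ k, |t k| ≤ c₂ / α ^ (k + 1) := fun k => hta (k + 1) (by omega)
  have hx : |x| < α := by rwa [abs_of_nonneg hx0]
  have hu : 0 < 1 - x / α := sub_pos.2 ((div_lt_one hα).2 hxα)
  set s : Set ℝ := Ioo (-α) α
  have hs : IsOpen s := isOpen_Ioo
  have hxs : x ∈ s := abs_lt.1 hx
  have hP : ∀ j, ∀ y ∈ s, HasDerivAt (derivSeries t j) (derivSeries t (j + 1) y) y :=
    fun j y hy => hasDerivAt_derivSeries hα ht j (abs_lt.2 hy)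
  have hda : ∀ y ∈ s, HasDerivAt a (derivSeries t 0 y * a y) y := by
    intro y hy
    have h := (hasDerivAt_tsum_pow_succ_div
      (fun z hz => summable_abs_derivCoeff hα ht 0 hz) (abs_lt.2 hy)).exp
    simp only [derivCoeff_zero] at h
    rw [show a = _ from funext ha]
    refine h.congr_deriv ?_
    simp only [derivSeries, derivCoeff_zero]
    exact mul_comm _ _
  have hca : ∀ n : ℕ, ContDiffOn ℝ n a s := by
    intro n
    induction n with
    | zero => exact contDiffOn_zero.2 fun y hy => (hda y hy).continuousAt.continuousWithinAt
    | succ n ih =>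
      push_cast
      refine (contDiffOn_succ_iff_deriv_of_isOpen hs).2
        ⟨fun y hy => (hda y hy).differentiableAt.differentiableWithinAt, by simp, ?_⟩
      exact ((contDiffOn_of_hasDerivAt_succ hs hP n 0).mul ih).congr fun y hy => (hda y hy).deriv
  induction i using Nat.strong_induction_on with
  | _ i ih =>
  cases i with
  | zero =>
    have hlog := (Real.hasSum_pow_div_log_of_abs_lt_one (x := x / α)
      (by rw [abs_of_nonneg (by positivity)]; exact (div_lt_one hα).2 hxα)).mul_left c₂
    have hle : |∑' k : ℕ, ta (k + 1) * x ^ (k + 1) / ((k : ℝ) + 1)|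
        ≤ c₂ * -Real.log (1 - x / α) := by
      rw [← Real.norm_eq_abs]
      refine tsum_of_norm_bounded hlog fun k => ?_
      have hk : (0 : ℝ) < (k : ℝ) + 1 := by positivity
      rw [Real.norm_eq_abs, abs_div, abs_mul, abs_of_pos hk, abs_of_nonneg (pow_nonneg hx0 _)]
      calc _ ≤ c₂ / α ^ (k + 1) * x ^ (k + 1) / ((k : ℝ) + 1) := by
            gcongr
            exact ht k
        _ = _ := by
            rw [div_pow]
            ring
    simp only [iteratedDeriv_zero, ffall, Finset.range_zero, Finset.prod_empty, pow_zero, inv_one, one_mul,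
      Nat.cast_zero, sub_zero]
    rw [ha, Real.abs_exp, Real.rpow_def_of_pos hu]
    refine Real.exp_le_exp.2 ((le_abs_self _).trans (hle.trans_eq ?_))
    ring
  | succ i =>
    have hleib : iteratedDeriv (i + 1) a x = ∑ j ∈ range (i + 1),
        (i.choose j : ℝ) * derivSeries t j x * iteratedDeriv (i - j) a x := by
      rw [iteratedDeriv_succ', Set.EqOn.iteratedDeriv_of_isOpen (g := derivSeries t 0 * a)
        (fun y hy => (hda y hy).deriv) hs i hxs, iteratedDeriv_mul
        ((contDiffOn_of_hasDerivAt_succ hs hP i 0).contDiffAt (hs.mem_nhds hxs))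
        ((hca i).contDiffAt (hs.mem_nhds hxs))]
      refine sum_congr rfl fun j _ => ?_
      rw [iteratedDeriv_of_hasDerivAt_succ hs hP j 0 hxs, zero_add]
    rw [hleib, ← sum_descFactorial_mul_ffall_rising, mul_sum, sum_mul]
    refine (abs_sum_le_sum_abs _ _).trans (sum_le_sum fun j hj => ?_)
    have hji : j ≤ i := Nat.lt_succ_iff.1 (mem_range.1 hj)
    have hPj := abs_derivSeries_le hα ht j hx
    rw [abs_of_nonneg hx0] at hPj
    have haj := ih (i - j) (by omega)
    have hR := ffall_rising_nonneg hc₂.le (i - j)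
    have hrpow : (1 - x / α) ^ (-c₂ - ((i + 1 : ℕ) : ℝ)) =
        1 / (1 - x / α) ^ (j + 1) * (1 - x / α) ^ (-c₂ - ((i - j : ℕ) : ℝ)) := by
      rw [one_div, ← Real.rpow_natCast, ← Real.rpow_neg hu.le, ← Real.rpow_add hu]
      congr 1
      push_cast [Nat.cast_sub hji]
      ring
    have hαpow : α ^ (i + 1) = α ^ (j + 1) * α ^ (i - j) := by
      rw [← pow_add]
      congr 1
      omega
    rw [abs_mul, abs_mul, Nat.abs_cast]
    calc _ ≤ (i.choose j : ℝ) *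
          (c₂ * (j.factorial : ℝ) / α ^ (j + 1) * (1 / (1 - x / α) ^ (j + 1))) *
          ((α ^ (i - j))⁻¹ * ffall (c₂ + ((i - j : ℕ) : ℝ) - 1) (i - j) *
            (1 - x / α) ^ (-c₂ - ((i - j : ℕ) : ℝ))) := by gcongr
      _ = _ := by
        rw [hrpow, hαpow, Nat.descFactorial_eq_factorial_mul_choose, mul_inv]
        push_cast
        ring
end

section
/- Under the stated hypotheses, for integers 0 ≤ m < n, the sum S₂ = ∑_{k=0}^{m} (binom(k−c₁,k)/binom(n+c₁−1,k)) · (β^k/k!) · ∫₀^β ((β−x)^{n−k}/(n−k)!) · a^{(n+1)}(x) dx satisfies |S₂| ≤ C_m · binom(n+c₂−1, n) · rⁿ · (1+c₂r) · (1−r)^{−c₂} for a constant C_m depending only on m; for m = 0 one may take C₀ = 12. -/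
/-- Termwise differentiation of a real power series inside an interval of convergence. -/
lemma hasDerivAt_tsum_mul_pow {u : ℕ → ℝ} {α x : ℝ} (hx : |x| < α)
    (hu : ∀ ρ : ℝ, 0 ≤ ρ → ρ < α → Summable fun k : ℕ => |u (k + 1)| * (k + 1) * ρ ^ k) :
    HasDerivAt (fun y => ∑' k, u k * y ^ k) (∑' k : ℕ, u (k + 1) * (k + 1) * x ^ k) x := by
  obtain ⟨ρ, hxρ, hρ⟩ := exists_between hx
  have hρ0 : 0 < ρ := (abs_nonneg x).trans_lt hxρ
  have hs := hu ρ hρ0.le hρ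
  have hbound : Summable fun k : ℕ => |u k| * k * ρ ^ (k - 1) := by
    rw [← summable_nat_add_iff 1]
    simpa using hs
  have key : HasDerivAt (fun y => ∑' k, u k * y ^ k) (∑' k : ℕ, u k * (k * x ^ (k - 1))) x := by
    refine hasDerivAt_tsum_of_isPreconnected (t := Set.Ioo (-ρ) ρ) (y₀ := 0) hbound isOpen_Ioo
      isPreconnected_Ioo (fun n y _ => (hasDerivAt_pow n y).const_mul (u n)) ?_
      ⟨neg_neg_of_pos hρ0, hρ0⟩ ?_ (abs_lt.mp hxρ)
    · intro n y hy
      rw [Real.norm_eq_abs, abs_mul, abs_mul, abs_pow, Nat.abs_cast, ← mul_assoc]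
      gcongr
      exact (abs_lt.mpr hy).le
    · refine summable_of_ne_finset_zero (s := {0}) fun n hn => ?_
      rw [zero_pow (by simpa using hn), mul_zero]
  convert key using 1
  have hsum : Summable fun k : ℕ => u k * (k * x ^ (k - 1)) := by
    refine Summable.of_norm_bounded hbound fun n => ?_
    rw [Real.norm_eq_abs, abs_mul, abs_mul, abs_pow, Nat.abs_cast, ← mul_assoc]
    gcongr
  rw [hsum.tsum_eq_zero_add]
  simp [mul_assoc]

/-- The `j`-th formal derivative of the power series `∑ t k * x ^ k`. -/
noncomputable def formalDerivSum (t : ℕ → ℝ) (j : ℕ) (x : ℝ) : ℝ :=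
  ∑' k : ℕ, ((j.factorial : ℝ) * ((k + j).choose j : ℝ) * t (k + j)) * x ^ k

lemma abs_formalDerivSum_term_le {t : ℕ → ℝ} {c α : ℝ} (hα : 0 < α)
    (ht : ∀ k, |t k| ≤ c / α ^ (k + 1)) (j k : ℕ) {x ρ : ℝ} (hx : |x| ≤ ρ) :
    |((j.factorial : ℝ) * ((k + j).choose j : ℝ) * t (k + j)) * x ^ k| ≤
      c * j.factorial / α ^ (j + 1) * (((k + j).choose j : ℝ) * (ρ / α) ^ k) := by
  have hρ : 0 ≤ ρ := (abs_nonneg x).trans hx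
  have hk := ht (k + j)
  have h0 : 0 ≤ c / α ^ (k + j + 1) := (abs_nonneg _).trans hk
  rw [abs_mul, abs_mul, abs_mul, abs_pow, Nat.abs_cast, Nat.abs_cast]
  calc _ ≤ (j.factorial : ℝ) * ((k + j).choose j : ℝ) * (c / α ^ (k + j + 1)) * ρ ^ k := by
        gcongr
    _ = _ := by
        rw [div_pow, show k + j + 1 = (j + 1) + k by ring, pow_add]
        field_simp

lemma hasDerivAt_formalDerivSum {t : ℕ → ℝ} {c α x : ℝ} (hα : 0 < α)
    (ht : ∀ k, |t k| ≤ c / α ^ (k + 1)) (j : ℕ) (hx : |x| < α) :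
    HasDerivAt (formalDerivSum t j) (formalDerivSum t (j + 1) x) x := by
  have hcoef : ∀ k : ℕ, ((j.factorial : ℝ) * ((k + 1 + j).choose j : ℝ) * t (k + 1 + j)) *
      ((k : ℝ) + 1) =
      ((j + 1).factorial : ℝ) * ((k + (j + 1)).choose (j + 1) : ℝ) * t (k + (j + 1)) := by
    intro k
    have h : (k + (j + 1)).choose (j + 1) * (j + 1) = (k + (j + 1)).choose j * (k + 1) := by
      rw [Nat.choose_succ_right_eq]
      congr 1
      omega
    have h' : ((k + (j + 1)).choose (j + 1) : ℝ) * (j + 1) =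
        ((k + (j + 1)).choose j : ℝ) * (k + 1) := by exact_mod_cast h
    rw [show k + 1 + j = k + (j + 1) by ring, Nat.factorial_succ]
    push_cast
    linear_combination (-(j.factorial : ℝ) * t (k + (j + 1))) * h'
  have h := hasDerivAt_tsum_mul_pow (α := α) (x := x)
    (u := fun k => (j.factorial : ℝ) * ((k + j).choose j : ℝ) * t (k + j)) hx ?_
  · simp only [hcoef] at h
    exact h
  · intro ρ hρ0 hρ
    have hgeo := (summable_choose_mul_geometric_of_norm_lt_one (j + 1) (r := ρ / α) (by
      rw [Real.norm_eq_abs, abs_of_nonneg (by positivity), div_lt_one hα]; exact hρ)).mul_left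
      (c * (j + 1).factorial / α ^ (j + 1 + 1))
    refine Summable.of_nonneg_of_le (fun k => by positivity) (fun k => ?_) hgeo
    have := abs_formalDerivSum_term_le hα ht (j + 1) k (abs_of_nonneg hρ0).le
    rw [← hcoef k, abs_mul, abs_mul, abs_of_nonneg (by positivity : (0 : ℝ) ≤ ρ ^ k),
      abs_of_nonneg (by positivity : (0 : ℝ) ≤ (k : ℝ) + 1)] at this
    exact this

lemma abs_formalDerivSum_le {t : ℕ → ℝ} {c α x : ℝ}
    (ht : ∀ k, |t k| ≤ c / α ^ (k + 1)) (j : ℕ) (hx0 : 0 ≤ x) (hx : x < α) :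
    |formalDerivSum t j x| ≤ c * j.factorial / (α - x) ^ (j + 1) := by
  have hα : 0 < α := hx0.trans_lt hx
  have hgeo := (hasSum_choose_mul_geometric_of_norm_lt_one j (r := x / α) (by
      rw [Real.norm_eq_abs, abs_of_nonneg (by positivity), div_lt_one hα]; exact hx)).mul_left
      (c * j.factorial / α ^ (j + 1))
  have h : |formalDerivSum t j x| ≤ _ := tsum_of_norm_bounded (E := ℝ) hgeo
    (fun k => abs_formalDerivSum_term_le hα ht j k (abs_of_nonneg hx0).le)
  refine h.trans_eq ?_
  have h1 : 1 - x / α = (α - x) / α := by field_simp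
  have h2 : α - x ≠ 0 := by linarith
  rw [h1, div_pow]
  field_simp

lemma abs_lt_mem_nhds {x α : ℝ} (hx : |x| < α) : {y : ℝ | |y| < α} ∈ nhds x :=
  (isOpen_lt continuous_abs continuous_const).mem_nhds hx

lemma iteratedDeriv_formalDerivSum {t : ℕ → ℝ} {c α x : ℝ} (hα : 0 < α)
    (ht : ∀ k, |t k| ≤ c / α ^ (k + 1)) (i j : ℕ) (hx : |x| < α) :
    iteratedDeriv i (formalDerivSum t j) x = formalDerivSum t (j + i) x := by
  induction i generalizing j with
  | zero => simp
  | succ i ih =>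
    rw [iteratedDeriv_succ', Filter.EventuallyEq.iteratedDeriv_eq (g := formalDerivSum t (j + 1)),
      ih (j + 1)]
    · congr 1; ring
    · filter_upwards [abs_lt_mem_nhds hx] with y hy
      exact (hasDerivAt_formalDerivSum hα ht j hy).deriv

lemma contDiffAt_formalDerivSum {t : ℕ → ℝ} {c α x : ℝ} (hα : 0 < α)
    (ht : ∀ k, |t k| ≤ c / α ^ (k + 1)) (i j : ℕ) (hx : |x| < α) :
    ContDiffAt ℝ i (formalDerivSum t j) x := by
  have hopen : IsOpen {y : ℝ | |y| < α} := isOpen_lt continuous_abs continuous_const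
  suffices h : ContDiffOn ℝ i (formalDerivSum t j) {y | |y| < α} from
    h.contDiffAt (abs_lt_mem_nhds hx)
  induction i generalizing j with
  | zero =>
    exact contDiffOn_zero.mpr fun y hy =>
      (hasDerivAt_formalDerivSum hα ht j hy).continuousAt.continuousWithinAt
  | succ i ih =>
    rw [Nat.cast_add, Nat.cast_one, contDiffOn_succ_iff_deriv_of_isOpen hopen]
    refine ⟨fun y hy =>
      (hasDerivAt_formalDerivSum hα ht j hy).differentiableAt.differentiableWithinAt,
      by simp, (ih (j + 1)).congr fun y hy => ?_⟩
    exact (hasDerivAt_formalDerivSum hα ht j hy).deriv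

lemma mul_sum_choose_mul_ascPochhammer (c : ℝ) (n : ℕ) :
    ∑ i ∈ Finset.range (n + 1), (n.choose i : ℝ) * (ascPochhammer ℝ i).eval c *
      (c * (n - i).factorial) = (ascPochhammer ℝ (n + 1)).eval c := by
  have hsum : ∀ n : ℕ, c * n.factorial * ∑ i ∈ Finset.range (n + 1),
      (ascPochhammer ℝ i).eval c / i.factorial = (ascPochhammer ℝ (n + 1)).eval c := by
    intro n
    induction n with
    | zero => simp
    | succ n ih =>
      have hf : ((n + 1).factorial : ℝ) ≠ 0 := by positivity
      rw [Finset.sum_range_succ, ascPochhammer_succ_eval (n + 1), mul_add]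
      have h1 : c * ((n + 1).factorial : ℝ) * ((ascPochhammer ℝ (n + 1)).eval c /
          (n + 1).factorial) = c * (ascPochhammer ℝ (n + 1)).eval c := by field_simp
      rw [h1, ← ih, Nat.factorial_succ]
      push_cast
      ring
  rw [← hsum, Finset.mul_sum]
  refine Finset.sum_congr rfl fun i hi => ?_
  have hin : i ≤ n := Nat.lt_succ_iff.mp (Finset.mem_range.mp hi)
  rw [Nat.cast_choose ℝ hin]
  have h1 : (i.factorial : ℝ) ≠ 0 := by positivity
  have h2 : ((n - i).factorial : ℝ) ≠ 0 := by positivity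
  field_simp

/-- The derivatives of `exp (∑ t k * x ^ (k + 1) / (k + 1))` are dominated by those of
`(1 - x / α) ^ (-c)` when `|t k| ≤ c / α ^ (k + 1)`. -/
lemma abs_iteratedDeriv_exp_tsum_le {t : ℕ → ℝ} {a : ℝ → ℝ} {c α : ℝ}
    (hc : 0 < c) (ht : ∀ k, |t k| ≤ c / α ^ (k + 1))
    (ha : ∀ x, a x = Real.exp (∑' k : ℕ, t k * x ^ (k + 1) / ((k : ℝ) + 1)))
    (n : ℕ) {x : ℝ} (hx0 : 0 ≤ x) (hx : x < α) :
    |iteratedDeriv n a x| ≤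
      (ascPochhammer ℝ n).eval c / (α - x) ^ n * (1 - x / α) ^ (-c) := by
  have hα : 0 < α := hx0.trans_lt hx
  have hxα : |x| < α := by rwa [abs_of_nonneg hx0]
  have hrα : |x / α| < 1 := by
    rw [abs_of_nonneg (by positivity), div_lt_one hα]; exact hx
  have hpos : 0 < 1 - x / α := by rw [abs_lt] at hrα; linarith
  set L : ℝ → ℝ := fun x => ∑' k : ℕ, t k * x ^ (k + 1) / ((k : ℝ) + 1)
  have haL : a = fun x => Real.exp (L x) := funext ha
  let u : ℕ → ℝ := fun k => t (k - 1) / k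
  have hLu : ∀ y, L y = ∑' k, u k * y ^ k := by
    intro y
    have hinj : Function.support (fun k => u k * y ^ k) ⊆ Set.range Nat.succ := by
      intro k hk
      rcases k with _ | k
      · simp [u] at hk
      · exact ⟨k, rfl⟩
    rw [← Nat.succ_injective.tsum_eq hinj]
    refine tsum_congr fun k => ?_
    simp only [u, Nat.succ_eq_add_one, Nat.add_sub_cancel]
    push_cast
    ring
  have hu : ∀ k : ℕ, u (k + 1) * (k + 1) = t k := by
    intro k
    simp only [u, Nat.add_sub_cancel]
    push_cast
    field_simp
  have hLd : ∀ y, |y| < α → HasDerivAt L (formalDerivSum t 0 y) y := by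
    intro y hy
    have h := hasDerivAt_tsum_mul_pow (u := u) hy ?_
    · rw [← funext hLu] at h
      simpa [hu, formalDerivSum] using h
    · intro ρ hρ0 hρ
      have hgeo := (summable_geometric_of_lt_one (r := ρ / α) (by positivity)
        (by rwa [div_lt_one hα])).mul_left (c / α)
      refine Summable.of_nonneg_of_le (fun k => by positivity) (fun k => ?_) hgeo
      have h1 : |u (k + 1)| * ((k : ℝ) + 1) = |t k| := by
        rw [← hu k, abs_mul, abs_of_nonneg (by positivity : (0 : ℝ) ≤ (k : ℝ) + 1)]
      rw [h1]
      calc |t k| * ρ ^ k ≤ c / α ^ (k + 1) * ρ ^ k := by gcongr; exact ht k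
        _ = _ := by rw [div_pow, pow_succ]; field_simp
  have hda : ∀ y, |y| < α → HasDerivAt a (a y * formalDerivSum t 0 y) y := by
    intro y hy
    rw [haL]
    exact (hLd y hy).exp
  have hca : ∀ n : ℕ, ContDiffAt ℝ n a x := by
    intro n
    have hLn : ContDiffOn ℝ ((n : WithTop ℕ∞) + 1) L {y | |y| < α} := by
      rw [contDiffOn_succ_iff_deriv_of_isOpen (isOpen_lt continuous_abs continuous_const)]
      exact ⟨fun y hy => (hLd y hy).differentiableAt.differentiableWithinAt, by simp,
        fun y hy => ((contDiffAt_formalDerivSum hα ht n 0 hy).contDiffWithinAt.congr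
          (fun z hz => (hLd z hz).deriv) (hLd y hy).deriv)⟩
    rw [haL]
    exact Real.contDiff_exp.contDiffAt.comp x
      ((hLn.contDiffAt (abs_lt_mem_nhds hxα)).of_le le_self_add)
  induction n using Nat.strong_induction_on with
  | _ n ih =>
    rcases n with _ | n
    · have hlog := (Real.hasSum_pow_div_log_of_abs_lt_one hrα).mul_left c
      have hLx : |L x| ≤ c * -Real.log (1 - x / α) := by
        refine tsum_of_norm_bounded (E := ℝ) hlog fun k => ?_
        rw [Real.norm_eq_abs, abs_div, abs_mul, abs_pow, abs_of_nonneg hx0,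
          abs_of_nonneg (by positivity : (0 : ℝ) ≤ (k : ℝ) + 1)]
        calc |t k| * x ^ (k + 1) / ((k : ℝ) + 1)
            ≤ c / α ^ (k + 1) * x ^ (k + 1) / ((k : ℝ) + 1) := by gcongr; exact ht k
          _ = _ := by rw [div_pow]; field_simp
      rw [iteratedDeriv_zero, ha, Real.abs_exp, Real.rpow_def_of_pos hpos]
      simp only [ascPochhammer_zero, Polynomial.eval_one, pow_zero, div_one, one_mul]
      refine Real.exp_le_exp.mpr ((le_abs_self _).trans (hLx.trans_eq ?_))
      ring
    · have hxx : 0 < α - x := by linarith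
      have hEq : deriv a =ᶠ[nhds x] a * formalDerivSum t 0 := by
        filter_upwards [abs_lt_mem_nhds hxα] with y hy
        exact (hda y hy).deriv
      rw [iteratedDeriv_succ', hEq.iteratedDeriv_eq,
        iteratedDeriv_mul (hca n) (contDiffAt_formalDerivSum hα ht n 0 hxα)]
      refine (Finset.abs_sum_le_sum_abs _ _).trans ?_
      rw [← mul_sum_choose_mul_ascPochhammer, Finset.sum_div, Finset.sum_mul]
      refine Finset.sum_le_sum fun i hi => ?_
      have hin : i ≤ n := Nat.lt_succ_iff.mp (Finset.mem_range.mp hi)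
      rw [iteratedDeriv_formalDerivSum hα ht _ _ hxα, zero_add, abs_mul, abs_mul, Nat.abs_cast]
      calc _ ≤ (n.choose i : ℝ) * ((ascPochhammer ℝ i).eval c / (α - x) ^ i *
              (1 - x / α) ^ (-c)) * (c * (n - i).factorial / (α - x) ^ (n - i + 1)) := by
            have h1 := ih i (by omega)
            gcongr
            · exact mul_nonneg (Nat.cast_nonneg _) ((abs_nonneg _).trans h1)
            · exact abs_formalDerivSum_le ht _ hx0 hx
        _ = _ := by
            rw [show n + 1 = i + (n - i + 1) by omega, pow_add]
            field_simp
            ring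

lemma integral_sub_pow_div_sub_pow {α β : ℝ} (hβ : 0 < β) (hβα : β < α) (p : ℕ) :
    ∫ x in (0 : ℝ)..β, (β - x) ^ p / (α - x) ^ (p + 2) =
      (β / α) ^ (p + 1) / ((p + 1) * (α - β)) := by
  have hne : ∀ x ∈ Set.uIcc 0 β, α - x ≠ 0 := by
    intro x hx
    rw [Set.uIcc_of_le hβ.le] at hx
    linarith [hx.2]
  have hab : α - β ≠ 0 := by linarith
  have hα : α ≠ 0 := by linarith
  have hp : (p : ℝ) + 1 ≠ 0 := by positivity
  rw [intervalIntegral.integral_eq_sub_of_hasDerivAt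
    (f := fun x => -(((β - x) / (α - x)) ^ (p + 1) / ((p + 1) * (α - β))))]
  · simp
  · intro x hx
    have hxx := hne x hx
    have h1 := (((hasDerivAt_id x).const_sub β).div ((hasDerivAt_id x).const_sub α) hxx)
    have h2 := ((h1.pow (p + 1)).div_const (((p : ℝ) + 1) * (α - β))).neg
    refine h2.congr_deriv ?_
    simp only [id, Pi.div_apply, Nat.add_sub_cancel, div_pow]
    push_cast
    field_simp
    ring
  · exact ContinuousOn.intervalIntegrable (ContinuousOn.div (by fun_prop) (by fun_prop)
      fun x hx => pow_ne_zero _ (hne x hx))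

lemma prod_range_cast_sub {N k : ℕ} (h : k ≤ N) :
    ∏ i ∈ Finset.range k, ((N : ℝ) - i) = (N.descFactorial k : ℝ) := by
  rw [Nat.descFactorial_eq_prod_range, Nat.cast_prod]
  refine Finset.prod_congr rfl fun i hi => ?_
  rw [Nat.cast_sub ((Finset.mem_range.mp hi).le.trans h)]

lemma abs_rbinom_sub_self_le_one {c : ℝ} (hc : c ∈ Set.Ioo (0 : ℝ) 1) (k : ℕ) :
    |rbinom ((k : ℝ) - c) k| ≤ 1 := by
  rw [rbinom, abs_div, Nat.abs_cast, div_le_one (by positivity), Finset.abs_prod,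
    ← Nat.descFactorial_self, ← prod_range_cast_sub le_rfl]
  refine Finset.prod_le_prod (fun i _ => abs_nonneg _) fun i hi => ?_
  have hik : (i : ℝ) + 1 ≤ k := by exact_mod_cast Finset.mem_range.mp hi
  rw [abs_le]
  constructor <;> linarith [hc.1, hc.2]

lemma choose_le_rbinom {c : ℝ} (hc : 0 ≤ c) {N k : ℕ} (h : k ≤ N) :
    (N.choose k : ℝ) ≤ rbinom ((N : ℝ) + c) k := by
  rw [rbinom, Nat.choose_eq_descFactorial_div_factorial,
    Nat.cast_div (Nat.factorial_dvd_descFactorial N k) (by positivity), ← prod_range_cast_sub h]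
  gcongr with i hi
  · intro i hi
    have hik : (i : ℝ) + 1 ≤ N := by exact_mod_cast (Finset.mem_range.mp hi).trans_le h
    linarith
  · linarith

lemma rbinom_add_sub_one_self (c : ℝ) (n : ℕ) :
    rbinom ((n : ℝ) + c - 1) n = (ascPochhammer ℝ n).eval c / n.factorial := by
  have h : ∀ n : ℕ, (ascPochhammer ℝ n).eval c = ∏ i ∈ Finset.range n, (c + i) := by
    intro n
    induction n with
    | zero => simp
    | succ n ih => rw [ascPochhammer_succ_eval, Finset.prod_range_succ, ih]
  rw [rbinom, h, ← Finset.prod_range_reflect]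
  congr 1
  refine Finset.prod_congr rfl fun i hi => ?_
  have := Finset.mem_range.mp hi
  rw [Nat.sub_sub, Nat.cast_sub (by omega)]
  push_cast
  ring

/-- Bound for the weighted Taylor remainder integrals of `exp (∑ t k * x ^ (k + 1) / (k + 1))`. -/
lemma abs_integral_iteratedDeriv_le {t : ℕ → ℝ} {a : ℝ → ℝ} {c α β : ℝ}
    (hc : 0 < c) (ht : ∀ k, |t k| ≤ c / α ^ (k + 1))
    (ha : ∀ x, a x = Real.exp (∑' k : ℕ, t k * x ^ (k + 1) / ((k : ℝ) + 1)))
    (hβ : 0 < β) (hβα : β < α) (p k : ℕ) :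
    |∫ x in (0 : ℝ)..β, ((β - x) ^ p / (p.factorial : ℝ)) * iteratedDeriv (p + k + 1) a x| ≤
      (ascPochhammer ℝ (p + k + 1)).eval c / p.factorial * (1 - β / α) ^ (-c) *
        (α / (α - β) ^ (k + 1)) * ((β / α) ^ (p + 1) / (p + 1)) := by
  have hα : 0 < α := hβ.trans hβα
  have hab : 0 < α - β := by linarith
  set K := (ascPochhammer ℝ (p + k + 1)).eval c
  have hK : 0 < K := ascPochhammer_pos _ _ hc
  have hr : 0 < 1 - β / α := by rw [sub_pos, div_lt_one hα]; exact hβα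
  set D := K / p.factorial * (1 - β / α) ^ (-c) * (α / (α - β) ^ k) with hD
  have hcont : ContinuousOn (fun x => D * ((β - x) ^ p / (α - x) ^ (p + 2))) (Set.uIcc 0 β) := by
    refine continuousOn_const.mul (ContinuousOn.div (by fun_prop) (by fun_prop) fun x hx => ?_)
    rw [Set.uIcc_of_le hβ.le] at hx
    exact pow_ne_zero _ (by linarith [hx.2])
  have hbound : IntervalIntegrable (fun x => D * ((β - x) ^ p / (α - x) ^ (p + 2)))
      MeasureTheory.volume 0 β := hcont.intervalIntegrable
  refine (intervalIntegral.norm_integral_le_of_norm_le (E := ℝ) hβ.le (Filter.Eventually.of_forall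
    fun x hx => ?_) hbound).trans_eq ?_
  · have hxα : x < α := hx.2.trans_lt hβα
    have hax : 0 < α - x := by linarith
    have hbx : 0 ≤ β - x := by linarith [hx.2]
    have hxr : 1 - β / α ≤ 1 - x / α := by gcongr; exact hx.2
    have hrp : (1 - x / α) ^ (-c) ≤ (1 - β / α) ^ (-c) :=
      Real.rpow_le_rpow_of_nonpos hr hxr (by linarith)
    have hd := abs_iteratedDeriv_exp_tsum_le hc ht ha (p + k + 1) hx.1.le hxα
    rw [Real.norm_eq_abs, abs_mul, abs_of_nonneg (by positivity)]
    have hfrac : 1 / (α - x) ^ (p + k + 1) ≤ α / (α - β) ^ k / (α - x) ^ (p + 2) := by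
      have h1 : 1 / (α - x) ^ (p + k + 1) = (α - x) / (α - x) ^ k / (α - x) ^ (p + 2) := by
        field_simp
        ring
      rw [h1]
      gcongr
      · linarith [hx.1]
      · exact hx.2
    calc (β - x) ^ p / p.factorial * |iteratedDeriv (p + k + 1) a x|
        ≤ (β - x) ^ p / p.factorial * (K * (α / (α - β) ^ k / (α - x) ^ (p + 2)) *
          (1 - β / α) ^ (-c)) := by
          gcongr
          refine hd.trans ?_
          rw [div_eq_mul_one_div]
          gcongr
          exact Real.rpow_nonneg (hr.le.trans hxr) _
      _ = _ := by rw [hD]; ring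
  · rw [intervalIntegral.integral_const_mul, integral_sub_pow_div_sub_pow hβ hβα, hD,
      pow_succ (α - β)]
    field_simp

lemma choose_add_succ_le (q k : ℕ) : (q + 1 + k).choose k ≤ (k + 1) * (q + k).choose k := by
  have h := Nat.choose_mul_succ_eq (q + k) k
  rw [show q + k + 1 - k = q + 1 by omega, show q + k + 1 = q + 1 + k by ring] at h
  refine Nat.le_of_mul_le_mul_right (c := q + 1) ?_ q.succ_pos
  rw [← h]
  nlinarith [Nat.zero_le ((q + k).choose k * (q * k))]

/-- Bound for one summand of `integral_bound`. -/
lemma abs_integral_bound_summand_le {t : ℕ → ℝ} {a : ℝ → ℝ} {c₁ c α β : ℝ}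
    (hc₁ : c₁ ∈ Set.Ioo (0 : ℝ) 1) (hc : 0 < c) (ht : ∀ k, |t k| ≤ c / α ^ (k + 1))
    (ha : ∀ x, a x = Real.exp (∑' k : ℕ, t k * x ^ (k + 1) / ((k : ℝ) + 1)))
    (hβ : 0 < β) (hβα : β < α) (hr : β / α ≤ 3 / 4) {k n : ℕ} (hkn : k < n) :
    |(rbinom ((k : ℝ) - c₁) k / rbinom ((n : ℝ) + c₁ - 1) k) * (β ^ k / (k.factorial : ℝ)) *
      ∫ x in (0 : ℝ)..β, ((β - x) ^ (n - k) / ((n - k).factorial : ℝ)) *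
        iteratedDeriv (n + 1) a x| ≤
      4 ^ (k + 1) * (k + 1) ^ 2 * (rbinom ((n : ℝ) + c - 1) n * (β / α) ^ n *
        (1 + c * (β / α)) * (1 - β / α) ^ (-c)) := by
  obtain ⟨q, rfl⟩ := Nat.exists_eq_add_of_lt hkn
  rw [show k + q + 1 = q + 1 + k by ring]
  have hα : 0 < α := hβ.trans hβα
  have hab : 0 < α - β := by linarith
  rw [show q + 1 + k - k = q + 1 by omega, rbinom_add_sub_one_self]
  have hI := abs_integral_iteratedDeriv_le hc ht ha hβ hβα (q + 1) k
  set I := ∫ x in (0 : ℝ)..β, ((β - x) ^ (q + 1) / ((q + 1).factorial : ℝ)) *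
    iteratedDeriv (q + 1 + k + 1) a x
  rw [ascPochhammer_succ_eval] at hI
  set K := (ascPochhammer ℝ (q + 1 + k)).eval c
  have hK : 0 < K := ascPochhammer_pos _ _ hc
  have hchoose : 0 < (((q + k).choose k : ℕ) : ℝ) := by
    exact_mod_cast Nat.choose_pos (Nat.le_add_left k q)
  have hP : |rbinom ((k : ℝ) - c₁) k / rbinom (((q + 1 + k : ℕ) : ℝ) + c₁ - 1) k| ≤
      1 / ((q + k).choose k : ℝ) := by
    have hden := choose_le_rbinom hc₁.1.le (Nat.le_add_left k q)
    rw [show ((q + 1 + k : ℕ) : ℝ) + c₁ - 1 = ((q + k : ℕ) : ℝ) + c₁ by push_cast; ring, abs_div,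
      abs_of_pos (hchoose.trans_le hden)]
    gcongr
    exact abs_rbinom_sub_self_le_one hc₁ k
  have hαβ : α / (α - β) ^ (k + 1) ≤ 4 ^ (k + 1) / α ^ k := by
    have h1 : α ≤ 4 * (α - β) := by
      rw [div_le_iff₀ hα] at hr
      linarith
    rw [div_le_div_iff₀ (by positivity) (by positivity)]
    calc α * α ^ k = α ^ (k + 1) := by ring
      _ ≤ (4 * (α - β)) ^ (k + 1) := by gcongr
      _ = _ := by rw [mul_pow]
  set r := β / α with hrdef
  have hr0 : 0 < r := by positivity
  set R := (1 - r) ^ (-c)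
  have hR : 0 ≤ R := Real.rpow_nonneg (by linarith) _
  have hlin : (c + (q + 1 + k : ℕ)) * r / ((q + 1 : ℕ) + 1) ≤ (k + 1) * (1 + c * r) := by
    rw [div_le_iff₀ (by positivity)]
    have hcr : 0 < c * r := by positivity
    have hr1 : r ≤ 1 := by linarith
    push_cast
    have h1 : ((q : ℝ) + 1 + k) * r ≤ (q : ℝ) + 1 + k := mul_le_of_le_one_right (by positivity) hr1
    have h2 : 0 ≤ (q : ℝ) * k := by positivity
    have h3 : 0 ≤ c * r * ((q : ℝ) * k + k * 2 + q + 1) := by positivity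
    nlinarith
  have hbin : ((q + 1 + k).factorial : ℝ) / (k.factorial * (q + 1).factorial) /
      (q + k).choose k ≤ k + 1 := by
    rw [div_le_iff₀ hchoose]
    have h1 : ((q + 1 + k).choose k : ℝ) =
        (q + 1 + k).factorial / (k.factorial * (q + 1).factorial) := by
      rw [Nat.cast_choose ℝ (Nat.le_add_left k (q + 1)), Nat.add_sub_cancel]
    rw [← h1]
    exact_mod_cast choose_add_succ_le q k
  rw [abs_mul, abs_mul, abs_of_nonneg (by positivity : 0 ≤ β ^ k / (k.factorial : ℝ))]
  have hβr : β = r * α := by rw [hrdef]; field_simp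
  calc _ ≤ 1 / ((q + k).choose k : ℝ) * (β ^ k / k.factorial) *
        (K * (c + (q + 1 + k : ℕ)) / (q + 1).factorial * R * (4 ^ (k + 1) / α ^ k) *
          (r ^ (q + 1 + 1) / ((q + 1 : ℕ) + 1))) := by
        gcongr
        refine hI.trans ?_
        gcongr
    _ = 4 ^ (k + 1) * ((((q + 1 + k).factorial : ℝ) / (k.factorial * (q + 1).factorial) /
          (q + k).choose k) * ((c + (q + 1 + k : ℕ)) * r / ((q + 1 : ℕ) + 1))) *
          (K / (q + 1 + k).factorial * r ^ (q + 1 + k) * R) := by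
        rw [hβr]
        field_simp
        ring
    _ ≤ 4 ^ (k + 1) * ((k + 1) * ((k + 1) * (1 + c * r))) *
          (K / (q + 1 + k).factorial * r ^ (q + 1 + k) * R) := by
        gcongr
    _ = _ := by ring

/-- Integral bound: with `0 < β < α`, `r = β/α ≤ 1/√2`, `c₁ ∈ (0,1)`, `c₂ > 0`,
`|ãₙ| ≤ c₂/αⁿ`, `a(x) = exp(∑_{n≥1} ãₙxⁿ/n)`: for `0 ≤ m < n`, the sum
`S₂ = ∑_{k=0}^{m} (binom(k−c₁,k)/binom(n+c₁−1,k)) (βᵏ/k!) ∫₀^β ((β−x)^{n−k}/(n−k)!) a⁽ⁿ⁺¹⁾(x) dx`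
satisfies `|S₂| ≤ C_m binom(n+c₂−1,n) rⁿ (1+c₂r)(1−r)^{−c₂}` with `C_m` depending only on `m`,
and `C₀ = 12`. -/
theorem integral_bound (m : ℕ) :
    ∃ Cm : ℝ, 0 < Cm ∧ (m = 0 → Cm = 12) ∧
      ∀ (α β c₁ c₂ : ℝ) (ta : ℕ → ℝ) (a : ℝ → ℝ),
        0 < β → β < α → β / α ≤ 1 / Real.sqrt 2 →
        c₁ ∈ Set.Ioo (0 : ℝ) 1 → 0 < c₂ →
        (∀ k : ℕ, 1 ≤ k → |ta k| ≤ c₂ / α ^ k) →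
        (∀ x : ℝ, a x = Real.exp (∑' k : ℕ, ta (k + 1) * x ^ (k + 1) / ((k : ℝ) + 1))) →
        ∀ n : ℕ, m < n →
          |∑ k ∈ Finset.range (m + 1),
              (rbinom ((k : ℝ) - c₁) k / rbinom ((n : ℝ) + c₁ - 1) k) *
                (β ^ k / (Nat.factorial k : ℝ)) *
                ∫ x in (0 : ℝ)..β,
                  ((β - x) ^ (n - k) / (Nat.factorial (n - k) : ℝ)) *
                    iteratedDeriv (n + 1) a x| ≤
            Cm * rbinom ((n : ℝ) + c₂ - 1) n * (β / α) ^ n * (1 + c₂ * (β / α)) *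
              (1 - β / α) ^ (-c₂) := by
  refine ⟨12 * ∑ k ∈ Finset.range (m + 1), 4 ^ k * ((k : ℝ) + 1) ^ 2, ?_, ?_, ?_⟩
  · exact mul_pos (by norm_num) (Finset.sum_pos (fun k _ => by positivity) (by simp))
  · rintro rfl
    norm_num
  intro α β c₁ c₂ ta a hβ hβα hr hc₁ hc₂ hta ha n hmn
  have hα : 0 < α := hβ.trans hβα
  have hr' : β / α ≤ 3 / 4 := by
    refine hr.trans ?_
    rw [div_le_div_iff₀ (by positivity) (by norm_num)]
    have : 4 / 3 ≤ Real.sqrt 2 := Real.le_sqrt_of_sq_le (by norm_num)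
    linarith
  have hrhs : 0 ≤ rbinom ((n : ℝ) + c₂ - 1) n * (β / α) ^ n * (1 + c₂ * (β / α)) *
      (1 - β / α) ^ (-c₂) := by
    have h1 : 0 ≤ (1 - β / α) ^ (-c₂) := Real.rpow_nonneg (by linarith) _
    have h2 : 0 < (ascPochhammer ℝ n).eval c₂ := ascPochhammer_pos _ _ hc₂
    rw [rbinom_add_sub_one_self]
    positivity
  refine (Finset.abs_sum_le_sum_abs _ _).trans ?_
  calc _ ≤ ∑ k ∈ Finset.range (m + 1), 12 * (4 ^ k * ((k : ℝ) + 1) ^ 2) *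
        (rbinom ((n : ℝ) + c₂ - 1) n * (β / α) ^ n * (1 + c₂ * (β / α)) *
          (1 - β / α) ^ (-c₂)) := by
        refine Finset.sum_le_sum fun k hk => ?_
        have hkn : k < n := (Nat.lt_succ_iff.mp (Finset.mem_range.mp hk)).trans_lt hmn
        refine (abs_integral_bound_summand_le hc₁ hc₂ (fun k => hta (k + 1) (by omega)) ha hβ hβα
          hr' hkn).trans (mul_le_mul_of_nonneg_right ?_ hrhs)
        have : (0 : ℝ) ≤ 4 ^ k * ((k : ℝ) + 1) ^ 2 := by positivity
        rw [pow_succ]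
        linarith
    _ = _ := by
        rw [← Finset.sum_mul, ← Finset.mul_sum]
        ring
end
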